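/- arXiv:1407.7774 — 2 statements merged into one kernel-verified Lean document; each statement's English description precedes it below -/
import Mathlib

section
/- For all integers r, m, n ≥ 1, the following identity holds in ℤ: r! · ∑_{σ ∈ Sym_r} m^{cyc(σ)} n^{cyc(ξ_r σ)} = ∑_{k=0}^{r−1} (−1)^k · C(r−1, k) · (∏_{j=0}^{r−1} (m−k+j)) · (∏_{j=0}^{r−1} (n−k+j)), where C(r−1,k) is the binomial coefficient and the products are the rising-factorial polynomials Γ(m+r−k)/Γ(m−k) and Γ(n+r−k)/Γ(n−k) interpreted as ∏_{j=0}^{r−1}(m−k+j), which vanish when k ≥ m (respectively k ≥ n). -/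
/-- Number of cycles of a permutation, counting fixed points as cycles of length 1
(i.e. the number of orbits). -/
def cyc {r : ℕ} (σ : Equiv.Perm (Fin r)) : ℕ :=
  σ.cycleType.card + (Finset.univ.filter fun x => σ x = x).card

open Equiv Equiv.Perm Finset in
/-- Number of cycles, on an arbitrary finite type. -/
def ncyc {α : Type*} [Fintype α] [DecidableEq α] (g : Equiv.Perm α) : ℕ :=
  g.cycleType.card + (Finset.univ.filter fun x => g x = x).card

set_option linter.unusedSectionVars false
set_option linter.unusedDecidableInType false
set_option linter.unusedFintypeInType false
section
open Equiv Equiv.Perm Finset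
variable {α : Type*} [Fintype α] [DecidableEq α]

/-- The orbit of a point. -/
noncomputable def orb (g : Perm α) (x : α) : Finset α :=
  haveI := Classical.decPred (g.SameCycle x)
  Finset.univ.filter (g.SameCycle x)

lemma mem_orb {g : Perm α} {x y : α} : y ∈ orb g x ↔ g.SameCycle x y := by
  simp [orb]

lemma orb_eq_iff {g : Perm α} {x y : α} : orb g x = orb g y ↔ g.SameCycle x y := by
  constructor
  · intro h
    rw [← mem_orb, h, mem_orb]
  · intro h
    ext z
    rw [mem_orb, mem_orb]
    exact ⟨fun hz => h.symm.trans hz, fun hz => h.trans hz⟩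

lemma ncyc_eq_orbs (g : Perm α) : ncyc g = (Finset.univ.image (orb g)).card := by
  have h1 : (Finset.univ : Finset α) = g.support ∪ univ.filter (fun x => g x = x) := by
    ext x; simp [em']
  have h2 : Disjoint (g.support.image (orb g)) ((univ.filter (fun x => g x = x)).image (orb g)) := by
    rw [Finset.disjoint_left]
    simp only [mem_image, not_exists, not_and]
    rintro _ ⟨x, hx, rfl⟩ y hy h
    rw [orb_eq_iff] at h
    have := h.apply_eq_self_iff
    simp at hx hy
    tauto
  rw [h1, image_union, card_union_of_disjoint h2, ncyc]
  congr 1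
  · rw [cycleType_def, Multiset.card_map]
    change g.cycleFactorsFinset.card = _
    have h3 : g.cycleFactorsFinset = g.support.image g.cycleOf := by
      ext c
      rw [mem_image]
      constructor
      · intro hc
        have hc' := mem_cycleFactorsFinset_iff.1 hc
        obtain ⟨x, hx⟩ := hc'.1.nonempty_support
        refine ⟨x, mem_cycleFactorsFinset_support_le hc hx, ?_⟩
        exact (cycle_is_cycleOf hx hc).symm
      · rintro ⟨x, hx, rfl⟩
        exact cycleOf_mem_cycleFactorsFinset_iff.2 hx
    have h4 : g.support.image (orb g) = (g.support.image g.cycleOf).image (fun c => c.support) := by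
      rw [image_image]
      apply image_congr
      intro x hx
      ext y
      simp only [Function.comp]
      rw [mem_orb, mem_support_cycleOf_iff' (by simpa using hx)]
    rw [h4, h3]
    symm
    apply card_image_of_injOn
    intro c hc d hd hcd
    rw [← h3] at hc hd
    have hc' := mem_cycleFactorsFinset_iff.1 hc
    obtain ⟨x, hx⟩ := hc'.1.nonempty_support
    have hx' : x ∈ d.support := by
      have : c.support = d.support := hcd
      rwa [← this]
    rw [cycle_is_cycleOf hx hc, cycle_is_cycleOf hx' hd]
  · rw [card_image_of_injOn]
    intro x hx y hy h
    have h := orb_eq_iff.1 h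
    apply h.eq_of_left
    have hx : g x = x := by simpa using hx
    exact hx

lemma sameCycle_induct {g : Perm α} (R : Setoid α) (h : ∀ x, R x (g x)) {x y : α}
    (hxy : g.SameCycle x y) : R x y := by
  obtain ⟨i, rfl⟩ := hxy
  have hn : ∀ (n : ℕ) (x : α), R x ((g ^ n) x) := by
    intro n
    induction n with
    | zero => intro x; exact R.refl _
    | succ n ih => 
      intro x
      rw [pow_succ', Perm.mul_apply]
      exact R.trans (ih x) (h _)
  obtain ⟨n, rfl | rfl⟩ := i.eq_nat_or_neg
  · simpa using hn n x
  · have := hn n ((g ^ (-(n:ℤ))) x)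
    apply R.symm
    simpa using this

lemma sameCycle_swap_mul {g : Perm α} {a b : α} (hab : ¬ g.SameCycle a b) :
    (swap a b * g).SameCycle a b := by
  have hex : ∃ i, (g ^ (i + 1)) a = a := by
    obtain ⟨n, hn, h⟩ := (isOfFinOrder_of_finite g).exists_pow_eq_one
    refine ⟨n - 1, ?_⟩
    rw [Nat.sub_add_cancel hn, h]; rfl
  classical
  have hfind := Nat.find_spec hex
  have hmin : ∀ j, j < Nat.find hex → (g ^ (j+1)) a ≠ a := fun j hj => Nat.find_min hex hj
  set i := Nat.find hex
  have key : ∀ j, j ≤ i → ((swap a b * g) ^ j) a = (g ^ j) a := by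
    intro j
    induction j with
    | zero => intro _; rfl
    | succ j ih =>
      intro hj
      rw [pow_succ', Perm.mul_apply, ih (by omega), Perm.mul_apply, ← Perm.mul_apply g,
        ← pow_succ']
      apply swap_apply_of_ne_of_ne
      · exact hmin j (by omega)
      · intro h
        exact hab ⟨(j+1 : ℕ), by rw [zpow_natCast]; exact h⟩
  refine ⟨(i+1 : ℕ), ?_⟩
  rw [zpow_natCast, pow_succ', Perm.mul_apply, key i le_rfl, Perm.mul_apply, ← Perm.mul_apply g,
        ← pow_succ', hfind, swap_apply_left]

lemma sameCycle_swap_mul_iff {g : Perm α} {a b : α} (hab : ¬ g.SameCycle a b) (x y : α) :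
    (swap a b * g).SameCycle x y ↔ g.SameCycle x y ∨
      ((g.SameCycle a x ∨ g.SameCycle b x) ∧ (g.SameCycle a y ∨ g.SameCycle b y)) := by
  have hs := sameCycle_swap_mul hab
  have hle : ∀ x y, g.SameCycle x y → (swap a b * g).SameCycle x y := by
    intro x y h
    refine sameCycle_induct (SameCycle.setoid (swap a b * g)) (fun x => ?_) h
    change (swap a b * g).SameCycle x (g x)
    have h1 : (swap a b * g).SameCycle x ((swap a b * g) x) := sameCycle_apply_right.2 (SameCycle.refl _ _)
    rw [Perm.mul_apply] at h1
    by_cases h2 : g x = a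
    · rw [h2, swap_apply_left] at h1; rw [h2]; exact h1.trans hs.symm
    by_cases h3 : g x = b
    · rw [h3, swap_apply_right] at h1; rw [h3]; exact h1.trans hs
    rwa [swap_apply_of_ne_of_ne h2 h3] at h1
  constructor
  · intro h
    let R : Setoid α :=
      { r := fun x y => g.SameCycle x y ∨
          ((g.SameCycle a x ∨ g.SameCycle b x) ∧ (g.SameCycle a y ∨ g.SameCycle b y))
        iseqv := by
          refine ⟨fun x => Or.inl (SameCycle.refl _ _), ?_, ?_⟩
          · rintro x y (h | ⟨h, h'⟩)
            · exact Or.inl h.symm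
            · exact Or.inr ⟨h', h⟩
          · rintro x y z (h | ⟨h, h'⟩) (k | ⟨k, k'⟩)
            · exact Or.inl (h.trans k)
            · exact Or.inr ⟨k.imp (fun t => t.trans h.symm) (fun t => t.trans h.symm), k'⟩
            · exact Or.inr ⟨h, h'.imp (fun t => t.trans k) (fun t => t.trans k)⟩
            · exact Or.inr ⟨h, k'⟩ }
    refine sameCycle_induct R (fun x => ?_) h
    change g.SameCycle x _ ∨ ((g.SameCycle a x ∨ g.SameCycle b x) ∧
      (g.SameCycle a _ ∨ g.SameCycle b _))
    have h1 : g.SameCycle (g x) x := sameCycle_apply_left.2 (SameCycle.refl _ _)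
    rw [Perm.mul_apply]
    by_cases h2 : g x = a
    · rw [h2, swap_apply_left]; rw [h2] at h1
      exact Or.inr ⟨Or.inl h1, Or.inr (SameCycle.refl _ _)⟩
    by_cases h3 : g x = b
    · rw [h3, swap_apply_right]; rw [h3] at h1
      exact Or.inr ⟨Or.inr h1, Or.inl (SameCycle.refl _ _)⟩
    rw [swap_apply_of_ne_of_ne h2 h3]
    exact Or.inl h1.symm
  · rintro (h | ⟨h, h'⟩)
    · exact hle _ _ h
    · have hx : (swap a b * g).SameCycle a x := h.elim (hle _ _) (fun t => hs.trans (hle _ _ t))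
      have hy : (swap a b * g).SameCycle a y := h'.elim (hle _ _) (fun t => hs.trans (hle _ _ t))
      exact hx.symm.trans hy

lemma ncyc_swap_mul {g : Perm α} {a b : α} (hab : ¬ g.SameCycle a b) :
    ncyc (swap a b * g) + 1 = ncyc g := by
  rw [ncyc_eq_orbs, ncyc_eq_orbs]
  have hiff := sameCycle_swap_mul_iff hab
  set g' := swap a b * g
  set N := univ.filter (fun x => ¬ (g.SameCycle a x ∨ g.SameCycle b x)) with hN
  have e1 : univ.image (orb g) = insert (orb g a) (insert (orb g b) (N.image (orb g))) := by
    ext O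
    simp only [mem_image, mem_insert, mem_univ, true_and]
    constructor
    · rintro ⟨x, rfl⟩
      by_cases h1 : g.SameCycle a x
      · exact Or.inl (orb_eq_iff.2 h1.symm)
      by_cases h2 : g.SameCycle b x
      · exact Or.inr (Or.inl (orb_eq_iff.2 h2.symm))
      · exact Or.inr (Or.inr ⟨x, by simp [hN, h1, h2], rfl⟩)
    · rintro (rfl | rfl | ⟨x, -, rfl⟩) <;> exact ⟨_, rfl⟩
  have e2 : univ.image (orb g') = insert (orb g' a) (N.image (orb g)) := by
    have e3 : N.image (orb g) = N.image (orb g') := by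
      apply image_congr
      intro x hx
      ext y
      have hx : ¬ (g.SameCycle a x ∨ g.SameCycle b x) := by simpa [hN] using hx
      rw [mem_orb, mem_orb, hiff]
      tauto
    rw [e3]
    ext O
    simp only [mem_image, mem_insert, mem_univ, true_and]
    constructor
    · rintro ⟨x, rfl⟩
      by_cases h1 : g.SameCycle a x ∨ g.SameCycle b x
      · left
        rw [orb_eq_iff, hiff]
        exact Or.inr ⟨h1, Or.inl (SameCycle.refl _ _)⟩
      · exact Or.inr ⟨x, by simpa [hN] using h1, rfl⟩
    · rintro (rfl | ⟨x, -, rfl⟩) <;> exact ⟨_, rfl⟩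
  have n1 : orb g b ∉ N.image (orb g) := by
    simp only [mem_image, not_exists, not_and]
    intro x hx h
    have hx : ¬ (g.SameCycle a x ∨ g.SameCycle b x) := by simpa [hN] using hx
    exact hx (Or.inr (orb_eq_iff.1 h).symm)
  have n2 : orb g a ∉ insert (orb g b) (N.image (orb g)) := by
    simp only [mem_insert, mem_image, not_or, not_exists, not_and]
    refine ⟨fun h => hab (orb_eq_iff.1 h), ?_⟩
    intro x hx h
    have hx : ¬ (g.SameCycle a x ∨ g.SameCycle b x) := by simpa [hN] using hx
    exact hx (Or.inl (orb_eq_iff.1 h).symm)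
  have n3 : orb g' a ∉ N.image (orb g) := by
    simp only [mem_image, not_exists, not_and]
    intro x hx h
    have hx : ¬ (g.SameCycle a x ∨ g.SameCycle b x) := by simpa [hN] using hx
    apply hx; left
    apply SameCycle.symm
    rw [← mem_orb, h, mem_orb]
  rw [e1, e2, card_insert_of_notMem n3, card_insert_of_notMem n2, card_insert_of_notMem n1]

lemma ncyc_add_sum (g : Perm α) : ncyc g + g.cycleType.sum = g.cycleType.card + Fintype.card α := by
  rw [ncyc, sum_cycleType, add_assoc, add_right_inj, ← Finset.card_univ, support]
  exact Finset.card_filter_add_card_filter_not (s := univ) (fun x => g x = x)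

lemma sign_eq_ncyc (g : Perm α) : ((sign g : ℤˣ) : ℤ) = (-1) ^ (Fintype.card α + ncyc g) := by
  rw [sign_of_cycleType]
  have h := ncyc_add_sum g
  push_cast
  rw [neg_one_pow_eq_pow_mod_two, neg_one_pow_eq_pow_mod_two (Fintype.card α + ncyc g)]
  congr 1
  omega

lemma ncyc_conj (g h : Perm α) : ncyc (h * g * h⁻¹) = ncyc g := by
  have h1 := ncyc_add_sum g
  have h2 := ncyc_add_sum (h * g * h⁻¹)
  rw [cycleType_conj] at h2
  omega

lemma ncyc_inv (g : Perm α) : ncyc g⁻¹ = ncyc g := by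
  have h1 := ncyc_add_sum g
  have h2 := ncyc_add_sum g⁻¹
  rw [cycleType_inv] at h2
  omega

end

section
open Equiv Equiv.Perm Finset

lemma cycleType_permCongr' {α β : Type*} [Fintype α] [DecidableEq α] [Fintype β] [DecidableEq β]
    (e : α ≃ β) (g : Perm α) : (e.permCongr g).cycleType = g.cycleType := by
  let f : α ≃ Subtype (fun _ : β => True) := e.trans (Equiv.Set.univ β).symm
  have h : e.permCongr g = g.extendDomain f := by
    ext x
    rw [extendDomain_apply_subtype _ _ trivial]
    rfl
  rw [h, cycleType_extendDomain]

lemma ncyc_permCongr {α β : Type*} [Fintype α] [DecidableEq α] [Fintype β] [DecidableEq β]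
    (e : α ≃ β) (g : Perm α) : ncyc (e.permCongr g) = ncyc g := by
  have h1 := ncyc_add_sum g
  have h2 := ncyc_add_sum (e.permCongr g)
  rw [cycleType_permCongr', ← Fintype.card_congr e] at h2
  omega

lemma cycleType_optionCongr' {α : Type*} [Fintype α] [DecidableEq α] 
    (g : Perm α) : Perm.cycleType (optionCongr g : Perm (Option α)) = g.cycleType := by
  let f : α ≃ Subtype (fun x : Option α => x ≠ none) := (optionIsSomeEquiv α).symm.trans
    (Equiv.subtypeEquivRight (fun x => by simp [Option.isSome_iff_ne_none]))
  have hf : ∀ a, (f a : Option α) = some a := fun a => rfl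
  have h : (optionCongr g : Perm (Option α)) = g.extendDomain f := by
    apply Equiv.ext
    intro x
    cases x with
    | none => rw [extendDomain_apply_not_subtype _ _ (by simp)]; rfl
    | some a => rw [← hf a, extendDomain_apply_image, hf, hf]; rfl
  rw [h, cycleType_extendDomain]

lemma ncyc_optionCongr {α : Type*} [Fintype α] [DecidableEq α] 
    (g : Perm α) : ncyc (optionCongr g : Perm (Option α)) = ncyc g + 1 := by
  have h1 := ncyc_add_sum g
  have h2 := ncyc_add_sum (optionCongr g : Perm (Option α))
  rw [cycleType_optionCongr', Fintype.card_option] at h2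
  omega

lemma sum_pow_ncyc (x : ℤ) (α : Type*) [hF : Fintype α] [hD : DecidableEq α] :
    ∑ g : Perm α, x ^ ncyc g = ∏ j ∈ range (Fintype.card α), (x + (j : ℤ)) := by
  revert hD
  refine Fintype.induction_empty_option (P := fun α _ => ∀ [DecidableEq α],
    ∑ g : Perm α, x ^ ncyc g = ∏ j ∈ range (Fintype.card α), (x + (j : ℤ))) ?_ ?_ ?_ α
  · intro α β hβ e ih hD
    let _ := Fintype.ofEquiv β e.symm
    classical
    have ih := ih
    rw [← Fintype.card_congr e, ← ih]
    symm
    apply Fintype.sum_equiv e.permCongr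
    intro g
    rw [ncyc_permCongr]
  · intro _
    simp [ncyc]
  · intro α hα ih hD
    classical
    obtain rfl : hD = (fun a b => a.instDecidableEq b) := Subsingleton.elim _ _
    have ih := ih
    rw [Fintype.card_option, prod_range_succ, ← ih]
    have : ∑ g : Perm (Option α), x ^ ncyc g =
        ∑ p : Option α × Perm α, x ^ ncyc (swap none p.1 * optionCongr p.2 : Perm (Option α)) := by
      apply Fintype.sum_equiv decomposeOption
      intro g
      congr 1
      conv_lhs => rw [← decomposeOption.symm_apply_apply g, decomposeOption_symm_apply]
    rw [this, Fintype.sum_prod_type, Fintype.sum_option]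
    have h1 : ∀ g : Perm α, ncyc (swap none none * optionCongr g : Perm (Option α)) = ncyc g + 1 := by
      intro g
      rw [swap_self, ← ncyc_optionCongr]; rfl
    have h2 : ∀ (a : α) (g : Perm α), ncyc (swap none (some a) * optionCongr g : Perm (Option α))
        = ncyc g := by
      intro a g
      have : ¬ Perm.SameCycle (optionCongr g : Perm (Option α)) none (some a) := by
        intro h
        have := h.eq_of_left (by rfl)
        simp at this
      have := ncyc_swap_mul this
      rw [ncyc_optionCongr] at this
      omega
    simp_rw [h1, h2, pow_succ, ← sum_mul]
    simp
    ring

lemma sum_sign_pow_ncyc (x : ℤ) (α : Type*) [hF : Fintype α] [hD : DecidableEq α] :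
    ∑ g : Perm α, ((sign g : ℤˣ) : ℤ) * x ^ ncyc g =
      ∏ j ∈ range (Fintype.card α), (x - (j : ℤ)) := by
  have h := sum_pow_ncyc (-x) α
  have : ∀ g : Perm α, ((sign g : ℤˣ) : ℤ) * x ^ ncyc g =
      (-1) ^ (Fintype.card α) * (-x) ^ ncyc g := by
    intro g
    rw [sign_eq_ncyc, neg_pow x, pow_add]; ring
  simp_rw [this, ← mul_sum, h]
  rw [← card_range (Fintype.card α), ← prod_const, card_range, ← prod_mul_distrib]
  apply prod_congr rfl
  intros; ring

variable {α : Type*} [Fintype α] [DecidableEq α]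

/-- The sign of `g` restricted to `S` if `g` preserves `S`, else zero. -/
def rsgn (S : Finset α) (g : Perm α) : ℤ :=
  if h : ∀ x, g x ∈ S ↔ x ∈ S then ((sign (g.subtypePerm (p := fun x => x ∈ S) h) : ℤˣ) : ℤ) else 0

lemma rsgn_of_not {S : Finset α} {g : Perm α} (h : ¬ ∀ x, g x ∈ S ↔ x ∈ S) : rsgn S g = 0 :=
  dif_neg h

lemma rsgn_mul_right (S : Finset α) (g h : Perm α) (hh : ∀ x, h x ∈ S ↔ x ∈ S) :
    rsgn S (g * h) = rsgn S g * rsgn S h := by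
  by_cases hg : ∀ x, g x ∈ S ↔ x ∈ S
  · have hgh : ∀ x, (g * h) x ∈ S ↔ x ∈ S := fun x => (hg _).trans (hh x)
    rw [rsgn, rsgn, rsgn, dif_pos hg, dif_pos hh, dif_pos hgh, ← Units.val_mul, ← Perm.sign_mul,
      subtypePerm_mul]
  · rw [rsgn_of_not hg, rsgn_of_not, zero_mul]
    intro hgh
    apply hg
    intro x
    have := hgh (h⁻¹ x)
    have h2 := hh (h⁻¹ x)
    rw [Perm.mul_apply] at this
    have h3 : h (h⁻¹ x) = x := by simp
    rw [h3] at this h2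
    tauto

lemma rsgn_mul_left (S : Finset α) (g h : Perm α) (hg : ∀ x, g x ∈ S ↔ x ∈ S) :
    rsgn S (g * h) = rsgn S g * rsgn S h := by
  by_cases hh : ∀ x, h x ∈ S ↔ x ∈ S
  · exact rsgn_mul_right S g h hh
  · rw [rsgn_of_not hh, rsgn_of_not, mul_zero]
    intro hgh
    exact hh fun x => (hg _).symm.trans (hgh x)

lemma rsgn_eq_sign (S : Finset α) (g : Perm α) (h : ∀ x, g x ≠ x → x ∈ S) :
    rsgn S g = ((sign g : ℤˣ) : ℤ) := by
  have hS : ∀ x, g x ∈ S ↔ x ∈ S := by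
    intro x
    by_cases hx : g x = x
    · rw [hx]
    · exact ⟨fun _ => h x hx, fun _ => h _ (fun h' => hx (g.injective h'))⟩
  rw [rsgn, dif_pos hS]
  rw [← sign_subtypePerm g hS h]
  congr!

lemma rsgn_eq_one (S : Finset α) (g : Perm α) (h : ∀ x, x ∈ S → g x = x) :
    rsgn S g = 1 := by
  have hS : ∀ x, g x ∈ S ↔ x ∈ S := by
    intro x
    refine ⟨fun hx => ?_, fun hx => by rwa [h x hx]⟩
    have := g.injective (h _ hx)
    rwa [this] at hx
  rw [rsgn, dif_pos hS]
  have : g.subtypePerm (p := fun x => x ∈ S) hS = 1 := by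
    ext x
    simp [h x.1 x.2]
  rw [this]; simp

lemma ncyc_mul_ofSubtype (S : Finset α) (p : Perm {x // x ∈ S}) (q : Perm {x // x ∉ S}) :
    ncyc (ofSubtype p * ofSubtype q) = ncyc p + ncyc q := by
  have hd : Perm.Disjoint (ofSubtype p) (ofSubtype q) := by
    intro x
    by_cases hx : x ∈ S
    · right; exact ofSubtype_apply_of_not_mem _ (by simpa using hx)
    · left; exact ofSubtype_apply_of_not_mem _ hx
  have h1 := ncyc_add_sum (ofSubtype p * ofSubtype q)
  have h2 := ncyc_add_sum p
  have h3 := ncyc_add_sum q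
  rw [hd.cycleType_mul, cycleType_ofSubtype, cycleType_ofSubtype, Multiset.sum_add, 
    Multiset.card_add] at h1
  have h4 := Fintype.card_subtype_compl (fun x => x ∈ S)
  have h5 := Fintype.card_subtype_le (fun x => x ∈ S)
  omega

lemma sum_rsgn_pow (S : Finset α) (x : ℤ) :
    ∑ g : Perm α, rsgn S g * x ^ ncyc g =
      (∏ j ∈ range S.card, (x - (j : ℤ))) *
        ∏ j ∈ range (Fintype.card α - S.card), (x + (j : ℤ)) := by
  have hc : Fintype.card {x // x ∈ S} = S.card := Fintype.card_coe S
  have hc' : Fintype.card {x // x ∉ S} = Fintype.card α - S.card := by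
    rw [Fintype.card_subtype_compl, hc]
  have e1 := sum_sign_pow_ncyc x {x // x ∈ S}
  have e2 := sum_pow_ncyc x {x // x ∉ S}
  rw [hc] at e1
  rw [hc'] at e2
  rw [← e1, ← e2, sum_mul_sum, ← sum_product', univ_product_univ]
  symm
  have hr : ∀ (p : Perm {x // x ∈ S}) (q : Perm {x // x ∉ S}),
      rsgn S (ofSubtype p * ofSubtype q) = ((sign p : ℤˣ) : ℤ) := by
    intro p q
    rw [rsgn_mul_left, rsgn_eq_sign S (ofSubtype p), rsgn_eq_one S (ofSubtype q), mul_one, sign_ofSubtype]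
    · intro x hx
      exact ofSubtype_apply_of_not_mem _ (by simpa using hx)
    · intro x hx
      by_contra h
      exact hx (ofSubtype_apply_of_not_mem _ h)
    · exact fun x => ofSubtype_apply_mem_iff_mem p x
  refine sum_of_injOn (fun pq => ofSubtype pq.1 * ofSubtype pq.2) ?_ (by simp) ?_ ?_
  · rintro ⟨p, q⟩ - ⟨p', q'⟩ - h
    have h := Equiv.ext_iff.1 h
    simp only [Perm.mul_apply] at h
    have hq : q = q' := by
      ext x
      have := h x
      rw [ofSubtype_apply_coe, ofSubtype_apply_coe, ofSubtype_apply_of_not_mem _ (q x).2,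
       ofSubtype_apply_of_not_mem _ (q' x).2] at this
      exact this
    have hp : p = p' := by
      ext x
      have := h x
      rw [ofSubtype_apply_of_not_mem (p := fun x => x ∉ S) _ (by simp), ofSubtype_apply_of_not_mem (p := fun x => x ∉ S) _ (by simp), ofSubtype_apply_coe, ofSubtype_apply_coe] at this
      exact this
    rw [hp, hq]
  · intro g _ hg
    rw [rsgn_of_not, zero_mul]
    intro hS
    apply hg
    refine ⟨(g.subtypePerm hS, g.subtypePerm (fun x => not_congr (hS x))), by simp, ?_⟩
    apply Equiv.ext
    intro x
    simp only [Perm.mul_apply]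
    by_cases hx : x ∈ S
    · rw [ofSubtype_apply_of_not_mem (p := fun x => x ∉ S) _ (by simpa using hx), 
        ofSubtype_apply_of_mem _ hx]
      rfl
    · rw [ofSubtype_apply_of_mem (p := fun x => x ∉ S) _ hx]
      rw [ofSubtype_apply_of_not_mem]
      · rfl
      · exact (not_congr (hS x)).2 hx
  · rintro ⟨p, q⟩ -
    simp only
    rw [hr, ncyc_mul_ofSubtype, pow_add]; ring

end

section
open Equiv Equiv.Perm Finset
variable {α : Type*} [Fintype α] [DecidableEq α]

lemma inv_iff_image (S : Finset α) (g : Perm α) : (∀ x, g x ∈ S ↔ x ∈ S) ↔ S.image g = S := by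
  constructor
  · intro h
    ext y
    rw [mem_image]
    constructor
    · rintro ⟨x, hx, rfl⟩; exact (h x).2 hx
    · intro hy
      refine ⟨g⁻¹ y, ?_, by simp⟩
      rw [← h]; simpa using hy
  · intro h x
    conv_lhs => rw [← h]
    rw [mem_image]
    constructor
    · rintro ⟨z, hz, e⟩; rwa [← g.injective e]
    · intro hx; exact ⟨x, hx, rfl⟩

lemma rsgn_eq_sign_ofSubtype (S : Finset α) (g : Perm α) (h : ∀ x, g x ∈ S ↔ x ∈ S) :
    rsgn S g = ((sign (ofSubtype (g.subtypePerm (p := fun x => x ∈ S) h)) : ℤˣ) : ℤ) := by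
  rw [rsgn, dif_pos h, sign_ofSubtype]

lemma rsgn_union (A B : Finset α) (g : Perm α) (hA : ∀ x, g x ∈ A ↔ x ∈ A)
    (hB : ∀ x, g x ∈ B ↔ x ∈ B) (hd : Disjoint A B) :
    rsgn (A ∪ B) g = rsgn A g * rsgn B g := by
  have hAB : ∀ x, g x ∈ A ∪ B ↔ x ∈ A ∪ B := by
    intro x; rw [mem_union, mem_union, hA, hB]
  rw [rsgn_eq_sign_ofSubtype _ _ hA, rsgn_eq_sign_ofSubtype _ _ hB, rsgn_eq_sign_ofSubtype _ _ hAB,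
    ← Units.val_mul, ← Perm.sign_mul]
  congr 2
  apply Equiv.ext
  intro x
  rw [Perm.mul_apply]
  by_cases hxB : x ∈ B
  · have hxA : x ∉ A := fun h => Finset.disjoint_left.1 hd h hxB
    rw [ofSubtype_subtypePerm_of_mem hB hxB, ofSubtype_subtypePerm_of_not_mem hA (by rwa [hA]),
      ofSubtype_subtypePerm_of_mem hAB (by simp [hxB])]
  · rw [ofSubtype_subtypePerm_of_not_mem hB hxB]
    by_cases hxA : x ∈ A
    · rw [ofSubtype_subtypePerm_of_mem hA hxA, ofSubtype_subtypePerm_of_mem hAB (by simp [hxA])]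
    · rw [ofSubtype_subtypePerm_of_not_mem hA hxA,
        ofSubtype_subtypePerm_of_not_mem hAB (by simp [hxA, hxB])]

lemma orb_inv (g : Perm α) (y : α) : ∀ x, g x ∈ orb g y ↔ x ∈ orb g y := by
  intro x
  rw [mem_orb, mem_orb, sameCycle_apply_right]

lemma rsgn_orb (g : Perm α) (y : α) : (-1) ^ (orb g y).card * rsgn (orb g y) g = -1 := by
  classical
  rw [rsgn_eq_sign_ofSubtype _ _ (orb_inv g y)]
  have : ofSubtype (g.subtypePerm (p := fun x => x ∈ orb g y) (orb_inv g y)) = g.cycleOf y := by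
    apply Equiv.ext
    intro x
    rw [cycleOf_apply]
    by_cases h : x ∈ orb g y
    · rw [ofSubtype_subtypePerm_of_mem (orb_inv g y) h, if_pos (mem_orb.1 h)]
    · rw [ofSubtype_subtypePerm_of_not_mem (orb_inv g y) h, if_neg (fun h' => h (mem_orb.2 h'))]
  rw [this]
  by_cases hy : g y = y
  · have h1 : orb g y = {y} := by
      ext x
      rw [mem_orb, mem_singleton]
      exact ⟨fun h => (h.eq_of_left hy).symm, fun h => by rw [h]⟩
    rw [(cycleOf_eq_one_iff g).2 hy, h1]
    simp
  · rw [(isCycle_cycleOf g hy).sign]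
    have h1 : (g.cycleOf y).support = orb g y := by
      ext x
      rw [mem_orb, mem_support_cycleOf_iff' hy]
    rw [h1]
    push_cast
    rw [mul_neg, ← mul_pow]
    simp

lemma sum_rsgn (x₀ : α) (g : Perm α) [Decidable (∀ y, g.SameCycle x₀ y)] :
    ∑ S ∈ (univ.erase x₀).powerset, (-1 : ℤ) ^ S.card * rsgn S g =
      if ∀ y, g.SameCycle x₀ y then 1 else 0 := by
  split_ifs with h
  · rw [sum_eq_single ∅]
    · rw [rsgn_eq_one]
      · simp
      · simp
    · intro S hS hne
      rw [rsgn_of_not, mul_zero]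
      intro hinv
      obtain ⟨y, hy⟩ := Finset.nonempty_iff_ne_empty.2 hne
      have := sameCycle_induct (g := g) (Setoid.comap (fun x => x ∈ S) ⊥)
        (fun x => propext (hinv x).symm) (h y)
      have h2 : (x₀ ∈ S) = (y ∈ S) := this
      have h3 : x₀ ∈ S := by rw [h2]; exact hy
      have := mem_powerset.1 hS h3
      simp at this
    · simp
  · push Not at h
    obtain ⟨y, hy⟩ := h
    set O := orb g y with hO
    have hx0 : x₀ ∉ O := by
      rw [hO, mem_orb]; exact fun h => hy h.symm
    have hyO : y ∈ O := mem_orb.2 (SameCycle.refl _ _)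
    have hOinv := orb_inv g y
    rw [← hO] at hOinv
    have hsub : ∀ S : Finset α, (∀ x, g x ∈ S ↔ x ∈ S) → y ∈ S → O ⊆ S := by
      intro S hinv hyS x hx
      have := sameCycle_induct (g := g) (Setoid.comap (fun x => x ∈ S) ⊥)
        (fun x => propext (hinv x).symm) (mem_orb.1 hx)
      have h2 : (y ∈ S) = (x ∈ S) := this
      rwa [← h2]
    have hinvsd : ∀ S : Finset α, (∀ x, g x ∈ S ↔ x ∈ S) → ∀ x, g x ∈ symmDiff S O ↔ x ∈ symmDiff S O := by
      intro S hinv x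
      rw [mem_symmDiff, mem_symmDiff, hinv, hOinv]
    have claim : ∀ S : Finset α, (∀ x, g x ∈ S ↔ x ∈ S) → Disjoint S O →
        (-1 : ℤ) ^ (S ∪ O).card * rsgn (S ∪ O) g = - ((-1 : ℤ) ^ S.card * rsgn S g) := by
      intro S hinv hd
      rw [card_union_of_disjoint hd, rsgn_union S O g hinv hOinv hd, pow_add]
      have := rsgn_orb g y
      rw [← hO] at this
      linear_combination (-1 : ℤ) ^ S.card * rsgn S g * this
    refine sum_involution (fun S _ => symmDiff S O) ?_ ?_ ?_ ?_
    · intro S hS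
      by_cases hinv : ∀ x, g x ∈ S ↔ x ∈ S
      · by_cases hyS : y ∈ S
        · have hOS := hsub S hinv hyS
          have h1 : symmDiff S O = S \ O := by
            rw [symmDiff_def, Finset.sup_eq_union, Finset.sdiff_eq_empty_iff_subset.2 hOS, union_empty]
          have h2 := claim (S \ O) (by rw [← h1]; exact hinvsd S hinv) sdiff_disjoint
          rw [sdiff_union_of_subset hOS] at h2
          rw [h1, h2]; ring
        · have hd : Disjoint S O := by
            rw [Finset.disjoint_left]
            intro x hx hxO
            have := sameCycle_induct (g := g) (Setoid.comap (fun x => x ∈ S) ⊥)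
              (fun x => propext (hinv x).symm) (mem_orb.1 hxO)
            have h2 : (y ∈ S) = (x ∈ S) := this
            rw [h2] at hyS
            exact hyS hx
          have h1 : symmDiff S O = S ∪ O := hd.symmDiff_eq_sup
          rw [h1, claim S hinv hd]; ring
      · rw [rsgn_of_not hinv, rsgn_of_not]
        · ring
        · intro h
          apply hinv
          have := hinvsd _ h
          rwa [symmDiff_symmDiff_cancel_right] at this
    · intro S hS _ h
      have := symmDiff_eq_left.1 h
      rw [this] at hyO
      simp at hyO
    · intro S hS
      rw [mem_powerset] at hS ⊢
      intro x hx
      rw [mem_erase]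
      refine ⟨?_, mem_univ _⟩
      rintro rfl
      rw [mem_symmDiff] at hx
      rcases hx with hx | hx
      · have := hS hx.1
        simp at this
      · exact hx0 hx.1
    · intro S hS
      exact symmDiff_symmDiff_cancel_right _ _

lemma not_sameCycle_of_inv {S : Finset α} {g : Perm α} (hinv : ∀ x, g x ∈ S ↔ x ∈ S) {a b : α}
    (ha : a ∈ S) (hb : b ∉ S) : ¬ g.SameCycle a b := by
  intro h
  have := sameCycle_induct (g := g) (Setoid.comap (fun x => x ∈ S) ⊥)
    (fun x => propext (hinv x).symm) h
  have h2 : (a ∈ S) = (b ∈ S) := this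
  rw [h2] at ha
  exact hb ha

/-- the partial sum over the permutations `τ` taking `S` to `T` -/
def Bsum (S : Finset α) (m n : ℤ) (T : Finset α) : ℤ :=
  ∑ τ ∈ univ.filter (fun τ : Perm α => S.image τ = T), ∑ σ : Perm α,
    m ^ ncyc σ * n ^ ncyc τ * rsgn S (σ * τ)

/-- the diagonal sum -/
def Asum (S : Finset α) (m : ℤ) : ℤ := ∑ g : Perm α, rsgn S g * m ^ ncyc g

lemma Asum_filter (S : Finset α) (m : ℤ) :
    Asum S m = ∑ τ ∈ univ.filter (fun τ : Perm α => S.image τ = S), rsgn S τ * m ^ ncyc τ := by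
  rw [Asum]
  symm
  apply sum_subset (subset_univ _)
  intro τ _ h
  rw [rsgn_of_not, zero_mul]
  rw [inv_iff_image]
  simpa using h

lemma Bsum_self (S : Finset α) (m n : ℤ) : Bsum S m n S = Asum S m * Asum S n := by
  rw [Bsum, Asum_filter S n, mul_sum]
  apply sum_congr rfl
  intro τ hτ
  rw [Asum, sum_mul]
  apply sum_congr rfl
  intro σ _
  rw [rsgn_mul_right]
  · ring
  · rw [inv_iff_image]; simpa using hτ

lemma Bsum_swap (S : Finset α) (m n : ℤ) {a b : α} (ha : a ∈ S) (hb : b ∉ S) :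
    m * n * Bsum S m n (S.image (swap a b)) = Asum S m * Asum S n := by
  have hss : swap a b * swap a b = 1 := swap_mul_self a b
  have h1 : Bsum S m n (S.image (swap a b)) =
      ∑ τ ∈ univ.filter (fun τ : Perm α => S.image τ = S), ∑ σ : Perm α,
        m ^ ncyc (σ * swap a b) * n ^ ncyc (swap a b * τ) * rsgn S (σ * τ) := by
    rw [Bsum]
    symm
    refine sum_nbij' (fun τ => swap a b * τ) (fun τ => swap a b * τ) ?_ ?_ ?_ ?_ ?_
    · intro τ hτ
      simp only [mem_filter, mem_univ, true_and] at hτ ⊢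
      rw [Perm.coe_mul, ← image_image, hτ]
    · intro τ hτ
      simp only [mem_filter, mem_univ, true_and] at hτ ⊢
      rw [Perm.coe_mul, ← image_image, hτ, image_image, ← Perm.coe_mul, hss]
      simp
    · intro τ _
      rw [← mul_assoc, hss, one_mul]
    · intro τ _
      rw [← mul_assoc, hss, one_mul]
    · intro τ _
      apply Fintype.sum_equiv (Equiv.mulRight (swap a b))
      intro σ
      simp only [Equiv.coe_mulRight]
      rw [mul_assoc σ, ← mul_assoc (swap a b) (swap a b), hss, one_mul]
  rw [h1, Asum_filter S n, mul_sum, mul_sum]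
  apply sum_congr rfl
  intro τ hτ
  have hτ : ∀ x, τ x ∈ S ↔ x ∈ S := by rw [inv_iff_image]; simpa using hτ
  rw [Asum, sum_mul, mul_sum]
  apply sum_congr rfl
  intro σ _
  rw [rsgn_mul_right _ _ _ hτ]
  by_cases hσ : ∀ x, σ x ∈ S ↔ x ∈ S
  · have e1 := ncyc_swap_mul (not_sameCycle_of_inv hτ ha hb)
    have e2 := ncyc_swap_mul (not_sameCycle_of_inv hσ ha hb)
    have e3 : ncyc (σ * swap a b) = ncyc (swap a b * σ) := by
      rw [← ncyc_conj (σ * swap a b) (swap a b)]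
      congr 1
      rw [mul_assoc, mul_assoc, mul_inv_cancel, mul_one]
    rw [e3, ← e1, ← e2, pow_succ, pow_succ]; ring
  · rw [rsgn_of_not hσ]; ring

lemma Bsum_zero (S T : Finset α) (m n : ℤ) {b c : α} (hbc : b ≠ c) (hb : b ∈ T) (hb' : b ∉ S)
    (hc : c ∈ T) (hc' : c ∉ S) : Bsum S m n T = 0 := by
  have hss : swap b c * swap b c = 1 := swap_mul_self b c
  have hfixS : ∀ x ∈ S, swap b c x = x := by
    intro x hx
    apply swap_apply_of_ne_of_ne
    · rintro rfl; exact hb' hx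
    · rintro rfl; exact hc' hx
  have hS : S.image (swap b c) = S := by
    conv_rhs => rw [← image_id (s := S)]
    exact image_congr fun x hx => hfixS x hx
  have hT : T.image (swap b c) = T := by
    rw [← inv_iff_image]
    intro x
    by_cases h1 : x = b
    · rw [h1, swap_apply_left]; tauto
    by_cases h2 : x = c
    · rw [h2, swap_apply_right]; tauto
    rw [swap_apply_of_ne_of_ne h1 h2]
  rw [Bsum, sum_comm]
  apply sum_eq_zero
  intro σ _
  suffices h : ∑ τ ∈ univ.filter (fun τ : Perm α => S.image τ = T),
      m ^ ncyc σ * n ^ ncyc τ * rsgn S (σ * τ) =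
      ∑ τ ∈ univ.filter (fun τ : Perm α => S.image τ = T),
      - (m ^ ncyc σ * n ^ ncyc τ * rsgn S (σ * τ)) by
    rw [sum_neg_distrib] at h
    omega
  refine sum_nbij' (fun τ => swap b c * τ * swap b c) (fun τ => swap b c * τ * swap b c) ?_ ?_ ?_ ?_ ?_
  · intro τ hτ
    simp only [mem_filter, mem_univ, true_and] at hτ ⊢
    rw [Perm.coe_mul, Perm.coe_mul, ← image_image, ← image_image, hS, hτ, hT]
  · intro τ hτ
    simp only [mem_filter, mem_univ, true_and] at hτ ⊢
    rw [Perm.coe_mul, Perm.coe_mul, ← image_image, ← image_image, hS, hτ, hT]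
  · intro τ _
    rw [mul_assoc, mul_assoc, hss, mul_one, ← mul_assoc, hss, one_mul]
  · intro τ _
    rw [mul_assoc, mul_assoc, hss, mul_one, ← mul_assoc, hss, one_mul]
  · intro τ hτ
    simp only [mem_filter, mem_univ, true_and] at hτ
    have e1 : ncyc (swap b c * τ * swap b c) = ncyc τ := by
      have := ncyc_conj τ (swap b c)
      rwa [swap_inv] at this
    rw [e1]
    by_cases hinv : ∀ x, (σ * τ) x ∈ S ↔ x ∈ S
    · have hσT : T.image σ = S := by
        rw [inv_iff_image, Perm.coe_mul, ← image_image, hτ] at hinv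
        exact hinv
      have hσb : σ b ∈ S := by rw [← hσT]; exact mem_image_of_mem _ hb
      have hσc : σ c ∈ S := by rw [← hσT]; exact mem_image_of_mem _ hc
      have e2 : σ * (swap b c * τ * swap b c) = swap (σ b) (σ c) * (σ * τ) * swap b c := by
        rw [← mul_assoc, ← mul_assoc, mul_swap_eq_swap_mul σ b c]
        simp only [mul_assoc]
      have hinv2 : ∀ x, swap b c x ∈ S ↔ x ∈ S := by rw [inv_iff_image]; exact hS
      have e3 : rsgn S (swap b c) = 1 := rsgn_eq_one _ _ hfixS
      have e4 : rsgn S (swap (σ b) (σ c)) = -1 := by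
        rw [rsgn_eq_sign, sign_swap]
        · simp
        · exact fun h => hbc (σ.injective h)
        · intro x hx
          by_contra hxS
          apply hx
          apply swap_apply_of_ne_of_ne
          · rintro rfl; exact hxS hσb
          · rintro rfl; exact hxS hσc
      rw [e2, rsgn_mul_right _ _ _ hinv2, rsgn_mul_right _ _ _ hinv, e3, e4]
      ring
    · rw [rsgn_of_not hinv, rsgn_of_not]
      · ring
      · rw [inv_iff_image] at hinv ⊢
        rw [Perm.coe_mul, ← image_image, hτ] at hinv
        rwa [Perm.coe_mul, Perm.coe_mul, Perm.coe_mul, ← image_image, ← image_image, ← image_image,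
          hS, hτ, hT]

lemma Bsum_zero_card (S T : Finset α) (m n : ℤ) (h : T.card ≠ S.card) : Bsum S m n T = 0 := by
  rw [Bsum, filter_false_of_mem, sum_empty]
  rintro τ - rfl
  exact h (card_image_of_injective _ τ.injective)

lemma image_swap_eq {S : Finset α} {a b : α} (ha : a ∈ S) (hb : b ∉ S) :
    S.image (swap a b) = insert b (S.erase a) := by
  have hab : a ≠ b := by rintro rfl; exact hb ha
  ext x
  simp only [mem_image, mem_insert, mem_erase]
  constructor
  · rintro ⟨y, hy, rfl⟩
    by_cases h1 : y = a
    · subst h1; simp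
    have h2 : y ≠ b := by rintro rfl; exact hb hy
    rw [swap_apply_of_ne_of_ne h1 h2]
    exact Or.inr ⟨h1, hy⟩
  · rintro (rfl | ⟨h1, h2⟩)
    · exact ⟨a, ha, by simp⟩
    · refine ⟨x, h2, swap_apply_of_ne_of_ne h1 ?_⟩
      rintro rfl; exact hb h2

lemma sum_sum_rsgn (S : Finset α) (m n : ℤ) :
    m * n * ∑ τ : Perm α, ∑ σ : Perm α, m ^ ncyc σ * n ^ ncyc τ * rsgn S (σ * τ) =
      Asum S m * Asum S n * (m * n + (S.card : ℤ) * ((Fintype.card α - S.card : ℕ) : ℤ)) := by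
  have h0 : ∑ τ : Perm α, ∑ σ : Perm α, m ^ ncyc σ * n ^ ncyc τ * rsgn S (σ * τ) =
      ∑ T : Finset α, Bsum S m n T :=
    (sum_fiberwise univ (fun τ : Perm α => S.image τ) _).symm
  set F : α × α → Finset α := fun p => S.image (swap p.1 p.2) with hF
  have hF' : ∀ p ∈ S ×ˢ Sᶜ, F p = insert p.2 (S.erase p.1) := by
    intro p hp
    simp only [mem_product, mem_compl] at hp
    exact image_swap_eq hp.1 hp.2
  have h1 : ∑ T : Finset α, Bsum S m n T =
      ∑ T ∈ insert S ((S ×ˢ Sᶜ).image F), Bsum S m n T := by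
    symm
    apply sum_subset (subset_univ _)
    intro T _ hT
    by_cases hc : T.card = S.card
    · have hd : (T \ S).card = (S \ T).card := card_sdiff_comm hc
      by_cases h2 : 1 < (T \ S).card
      · obtain ⟨b, hb, c, hc, hbc⟩ := one_lt_card.1 h2
        rw [mem_sdiff] at hb hc
        exact Bsum_zero S T m n hbc hb.1 hb.2 hc.1 hc.2
      · exfalso
        apply hT
        rw [mem_insert]
        by_cases h3 : (T \ S).card = 0
        · left
          rw [card_eq_zero, sdiff_eq_empty_iff_subset] at h3
          exact eq_of_subset_of_card_le h3 hc.ge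
        · right
          have h4 : (T \ S).card = 1 := by omega
          obtain ⟨b, hb⟩ := card_eq_one.1 h4
          obtain ⟨a, ha⟩ := card_eq_one.1 (hd ▸ h4)
          have hb1 : b ∈ T \ S := by rw [hb]; simp
          have ha1 : a ∈ S \ T := by rw [ha]; simp
          rw [mem_sdiff] at hb1 ha1
          have hp : (a, b) ∈ S ×ˢ Sᶜ := by simp [hb1, ha1]
          refine mem_image.2 ⟨(a, b), hp, ?_⟩
          rw [hF' _ hp]
          ext x
          have hbx : x ∈ T \ S ↔ x = b := by rw [hb, mem_singleton]
          have hax : x ∈ S \ T ↔ x = a := by rw [ha, mem_singleton]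
          rw [mem_sdiff] at hbx hax
          rw [mem_insert, mem_erase]
          tauto
    · exact Bsum_zero_card S T m n hc
  have h2 : S ∉ (S ×ˢ Sᶜ).image F := by
    rw [mem_image]
    rintro ⟨p, hp, h⟩
    have h3 := hF' p hp
    simp only [mem_product, mem_compl] at hp
    apply hp.2
    rw [← h, h3]; simp
  have h3 : Set.InjOn F (S ×ˢ Sᶜ : Finset (α × α)) := by
    rintro ⟨a, b⟩ hp ⟨a', b'⟩ hq h
    rw [hF' _ hp, hF' _ hq] at h
    simp only [coe_product, Set.mem_prod, mem_coe, mem_compl] at hp hq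
    have k1 := Finset.ext_iff.1 h a
    have k2 := Finset.ext_iff.1 h b
    simp only [mem_insert, mem_erase] at k1 k2
    have e1 : a = a' := by
      by_contra hne
      have : a ≠ b := by rintro rfl; exact hp.2 hp.1
      tauto
    have e2 : b = b' := by
      by_contra hne
      tauto
    rw [e1, e2]
  rw [h0, h1, sum_insert h2, sum_image h3, Bsum_self, mul_add, mul_sum]
  have h4 : ∀ p ∈ S ×ˢ Sᶜ, m * n * Bsum S m n (F p) = Asum S m * Asum S n := by
    intro p hp
    simp only [mem_product, mem_compl] at hp
    exact Bsum_swap S m n hp.1 hp.2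
  rw [sum_congr rfl h4, sum_const, card_product, card_compl, nsmul_eq_mul]
  push_cast
  ring

end

section
open Equiv Equiv.Perm Finset

lemma cyc_eq_ncyc {r : ℕ} (g : Perm (Fin r)) : cyc g = ncyc g := rfl

lemma full_iff (R : ℕ) (g : Perm (Fin (R + 2))) :
    (∀ y, g.SameCycle 0 y) ↔ g.cycleType = {R + 2} := by
  constructor
  · intro h
    have h0 : g 0 ≠ 0 := by
      intro h0
      have := (h 1).eq_of_left h0
      simp at this
    have hall : ∀ y, g y ≠ y := fun y hy => h0 ((h y).apply_eq_self_iff.2 hy)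
    have hc : g.IsCycle := (isCycle_iff_sameCycle h0).2 fun {y} => ⟨fun _ => hall y, fun _ => h y⟩
    rw [hc.cycleType]
    have : g.support = univ := by
      ext y; simp [hall y]
    rw [this]; simp
  · intro h y
    have hc : g.IsCycle := by
      rw [← card_cycleType_eq_one, h]; simp
    have hs : g.support = univ := by
      rw [← card_eq_iff_eq_univ, ← sum_cycleType, h]; simp
    have hall : ∀ y, g y ≠ y := fun y => by
      rw [← mem_support, hs]; simp
    exact hc.sameCycle (hall _) (hall _)

lemma sum_full (R : ℕ) (m n : ℤ) [∀ g : Perm (Fin (R + 2)), Decidable (∀ y, g.SameCycle 0 y)] :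
    ∑ τ : Perm (Fin (R + 2)), ∑ σ : Perm (Fin (R + 2)), m ^ ncyc σ * n ^ ncyc τ *
      (if ∀ y, (σ * τ).SameCycle 0 y then (1 : ℤ) else 0) =
    (Nat.factorial (R + 1) : ℤ) *
      ∑ σ : Perm (Fin (R + 2)), m ^ ncyc σ * n ^ ncyc (finRotate (R + 2) * σ) := by
  set ξ := finRotate (R + 2)
  have h1 : ∑ τ : Perm (Fin (R + 2)), ∑ σ : Perm (Fin (R + 2)), m ^ ncyc σ * n ^ ncyc τ *
      (if ∀ y, (σ * τ).SameCycle 0 y then (1 : ℤ) else 0) =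
      ∑ g : Perm (Fin (R + 2)), ∑ σ : Perm (Fin (R + 2)), m ^ ncyc σ * n ^ ncyc (σ⁻¹ * g) *
        (if ∀ y, g.SameCycle 0 y then (1 : ℤ) else 0) := by
    refine sum_comm.trans (Eq.trans ?_ sum_comm)
    apply sum_congr rfl
    intro σ _
    apply Fintype.sum_equiv (Equiv.mulLeft σ)
    intro τ
    simp only [Equiv.coe_mulLeft]
    rw [inv_mul_cancel_left]
    congr
  rw [h1]
  have h2 : ∀ g : Perm (Fin (R + 2)), ∑ σ : Perm (Fin (R + 2)), m ^ ncyc σ * n ^ ncyc (σ⁻¹ * g) *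
        (if ∀ y, g.SameCycle 0 y then (1 : ℤ) else 0) =
      if g.cycleType = {R + 2} then
        ∑ σ : Perm (Fin (R + 2)), m ^ ncyc σ * n ^ ncyc (ξ * σ) else 0 := by
    intro g
    by_cases hg : g.cycleType = {R + 2}
    · rw [if_pos hg, if_pos ((full_iff R g).2 hg)]
      have hconj : IsConj ξ g := by
        rw [isConj_iff_cycleType_eq, hg]
        exact cycleType_finRotate
      obtain ⟨c, hc⟩ := isConj_iff.1 hconj
      symm
      apply Fintype.sum_equiv ((Equiv.inv _).trans (MulAut.conj c).toEquiv)
      intro σ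
      have e0 : ((Equiv.inv (Perm (Fin (R + 2)))).trans (MulAut.conj c).toEquiv) σ = c * σ⁻¹ * c⁻¹ := rfl
      rw [e0, ncyc_conj, ncyc_inv, mul_one]
      have e1 : (c * σ⁻¹ * c⁻¹)⁻¹ * g = c * (σ * ξ) * c⁻¹ := by
        rw [← hc]; group
      rw [e1, ncyc_conj]
      have e2 : ξ * σ = ξ * (σ * ξ) * ξ⁻¹ := by group
      rw [e2, ncyc_conj]
    · rw [if_neg hg, if_neg (fun h => hg ((full_iff R g).1 h))]
      simp
  rw [sum_congr rfl (fun g _ => h2 g), ← sum_filter, sum_const,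
    card_of_cycleType_singleton (by omega) (by simp)]
  simp

lemma main_identity (R : ℕ) (m n : ℤ) :
    m * n * ((Nat.factorial (R + 1) : ℤ) *
      ∑ σ : Perm (Fin (R + 2)), m ^ ncyc σ * n ^ ncyc (finRotate (R + 2) * σ)) =
    ∑ k ∈ range (R + 2), (-1 : ℤ) ^ k * (Nat.choose (R + 1) k : ℤ) *
      (((∏ j ∈ range k, (m - (j : ℤ))) * ∏ j ∈ range (R + 2 - k), (m + (j : ℤ))) *
       ((∏ j ∈ range k, (n - (j : ℤ))) * ∏ j ∈ range (R + 2 - k), (n + (j : ℤ)))) *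
       (m * n + (k : ℤ) * ((R + 2 - k : ℕ) : ℤ)) := by
  classical
  rw [← sum_full]
  have h1 : ∀ τ σ : Perm (Fin (R + 2)), m ^ ncyc σ * n ^ ncyc τ *
      (if ∀ y, (σ * τ).SameCycle 0 y then (1 : ℤ) else 0) =
      ∑ S ∈ (univ.erase (0 : Fin (R + 2))).powerset, (-1 : ℤ) ^ S.card *
        (m ^ ncyc σ * n ^ ncyc τ * rsgn S (σ * τ)) := by
    intro τ σ
    rw [← sum_rsgn, mul_sum]
    apply sum_congr rfl
    intros; ring
  simp_rw [h1]
  have h2 : ∑ τ : Perm (Fin (R + 2)), ∑ σ : Perm (Fin (R + 2)),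
      ∑ S ∈ (univ.erase (0 : Fin (R + 2))).powerset, (-1 : ℤ) ^ S.card *
        (m ^ ncyc σ * n ^ ncyc τ * rsgn S (σ * τ)) =
      ∑ S ∈ (univ.erase (0 : Fin (R + 2))).powerset, (-1 : ℤ) ^ S.card *
       ∑ τ : Perm (Fin (R + 2)), ∑ σ : Perm (Fin (R + 2)),
        (m ^ ncyc σ * n ^ ncyc τ * rsgn S (σ * τ)) := by
    simp_rw [mul_sum]
    refine (sum_congr rfl (fun τ _ => sum_comm)).trans sum_comm
  rw [h2, mul_sum]
  have h3 : ∀ S ∈ (univ.erase (0 : Fin (R + 2))).powerset,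
      m * n * ((-1 : ℤ) ^ S.card * ∑ τ : Perm (Fin (R + 2)), ∑ σ : Perm (Fin (R + 2)),
        (m ^ ncyc σ * n ^ ncyc τ * rsgn S (σ * τ))) =
      (fun k => (-1 : ℤ) ^ k *
      (((∏ j ∈ range k, (m - (j : ℤ))) * ∏ j ∈ range (R + 2 - k), (m + (j : ℤ))) *
       ((∏ j ∈ range k, (n - (j : ℤ))) * ∏ j ∈ range (R + 2 - k), (n + (j : ℤ)))) *
       (m * n + (k : ℤ) * ((R + 2 - k : ℕ) : ℤ))) S.card := by
    intro S _
    have h := sum_sum_rsgn S m n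
    rw [Asum, Asum, sum_rsgn_pow, sum_rsgn_pow, Fintype.card_fin] at h
    simp only
    linear_combination (-1 : ℤ) ^ S.card * h
  refine (sum_congr rfl h3).trans ((sum_powerset_apply_card (fun k : ℕ => (-1 : ℤ) ^ k *
      (((∏ j ∈ range k, (m - (j : ℤ))) * ∏ j ∈ range (R + 2 - k), (m + (j : ℤ))) *
       ((∏ j ∈ range k, (n - (j : ℤ))) * ∏ j ∈ range (R + 2 - k), (n + (j : ℤ)))) *
       (m * n + (k : ℤ) * ((R + 2 - k : ℕ) : ℤ)))).trans ?_)
  simp only [mem_univ, card_erase_of_mem, card_univ, Fintype.card_fin]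
  apply sum_congr rfl
  intro k _
  rw [nsmul_eq_mul]
  simp only [show R + 2 - 1 = R + 1 by omega]
  ring

lemma prod_lo (r k : ℕ) (hk : k < r) (m : ℤ) :
    m * ∏ j ∈ range r, (m - (k : ℤ) + (j : ℤ)) =
      ((∏ j ∈ range k, (m - (j : ℤ))) * ∏ j ∈ range (r - k), (m + (j : ℤ))) * (m - k) := by
  obtain ⟨d, rfl⟩ : ∃ d, r = k + d := ⟨r - k, by omega⟩
  rw [prod_range_add, Nat.add_sub_cancel_left]
  have h1 : ∏ j ∈ range d, (m - (k : ℤ) + ((k + j : ℕ) : ℤ)) = ∏ j ∈ range d, (m + (j : ℤ)) := by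
    apply prod_congr rfl
    intros; push_cast; ring
  have h2 : m * ∏ j ∈ range k, (m - (k : ℤ) + (j : ℤ)) = (∏ j ∈ range k, (m - (j : ℤ))) * (m - k) := by
    rw [← prod_range_succ (fun j : ℕ => m - (j : ℤ)), 
      ← prod_range_reflect (fun j : ℕ => m - (j : ℤ)) (k + 1), prod_range_succ]
    rw [mul_comm]
    congr 1
    · apply prod_congr rfl
      intro j hj
      have := mem_range.1 hj
      rw [show k + 1 - 1 - j = k - j by omega, Nat.cast_sub (by omega)]
      ring
    · simp
  rw [h1]
  linear_combination (∏ j ∈ range d, (m + (j : ℤ))) * h2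

lemma prod_hi (r k : ℕ) (hk : k < r) (m : ℤ) :
    m * ∏ j ∈ range r, (m - (k : ℤ) + (j : ℤ)) =
      ((∏ j ∈ range (k + 1), (m - (j : ℤ))) * ∏ j ∈ range (r - (k + 1)), (m + (j : ℤ))) *
        (m + r - (k + 1)) := by
  rw [prod_lo r k hk, prod_range_succ]
  rw [show r - k = r - (k + 1) + 1 by omega, prod_range_succ, Nat.cast_sub (by omega)]
  push_cast
  ring

lemma telescoping (r : ℤ) (t : ℕ → ℤ) (K : ℕ) :
    ∑ k ∈ range (K + 1), (-1 : ℤ) ^ k * (r - k) * (t k + if k = 0 then 0 else t (k - 1)) =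
      ∑ k ∈ range (K + 1), (-1 : ℤ) ^ k * t k + (-1) ^ K * (r - (K + 1)) * t K := by
  induction K with
  | zero => simp; ring
  | succ K ih =>
    rw [sum_range_succ, ih, sum_range_succ _ (K + 1)]
    simp
    ring

lemma final_algebra (R : ℕ) (m n : ℤ) :
    ((R + 1 : ℕ) : ℤ) * ∑ k ∈ range (R + 1), (-1 : ℤ) ^ k * (Nat.choose R k : ℤ) *
      (((∏ j ∈ range k, (m - (j : ℤ))) * ∏ j ∈ range (R + 1 - k), (m + (j : ℤ))) *
       ((∏ j ∈ range k, (n - (j : ℤ))) * ∏ j ∈ range (R + 1 - k), (n + (j : ℤ)))) *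
       (m * n + (k : ℤ) * ((R + 1 - k : ℕ) : ℤ)) =
    m * n * ∑ k ∈ range (R + 1), (-1 : ℤ) ^ k * (Nat.choose R k : ℤ) *
        (∏ j ∈ range (R + 1), (m - (k : ℤ) + (j : ℤ))) *
        (∏ j ∈ range (R + 1), (n - (k : ℤ) + (j : ℤ))) := by
  set t : ℕ → ℤ := fun k => (Nat.choose R k : ℤ) *
        (∏ j ∈ range (R + 1), (m - (k : ℤ) + (j : ℤ))) *
        (∏ j ∈ range (R + 1), (n - (k : ℤ) + (j : ℤ))) with ht
  have htel := telescoping ((R : ℤ) + 1) t R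
  rw [show (R : ℤ) + 1 - (R + 1) = 0 by ring, mul_zero, zero_mul, add_zero] at htel
  have e : ∑ k ∈ range (R + 1), (-1 : ℤ) ^ k * (Nat.choose R k : ℤ) *
        (∏ j ∈ range (R + 1), (m - (k : ℤ) + (j : ℤ))) *
        (∏ j ∈ range (R + 1), (n - (k : ℤ) + (j : ℤ))) =
        ∑ k ∈ range (R + 1), (-1 : ℤ) ^ k * t k := by
    apply sum_congr rfl
    intros; rw [ht]; ring
  rw [e, ← htel, mul_sum, mul_sum]
  apply sum_congr rfl
  intro k hk
  have hk := mem_range.1 hk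
  have p1 := prod_lo (R + 1) k hk m
  have p2 := prod_lo (R + 1) k hk n
  cases k with
  | zero =>
    simp only [if_true, ht]
    simp
    ring
  | succ k =>
    have q1 := prod_hi (R + 1) k (by omega) m
    have q2 := prod_hi (R + 1) k (by omega) n
    have c1 : ((R : ℤ) - k) * (Nat.choose R k : ℤ) = ((k : ℤ) + 1) * (Nat.choose R (k + 1) : ℤ) := by
      have := Nat.choose_succ_right_eq R k
      have h2 : ((R - k : ℕ) : ℤ) = (R : ℤ) - k := by rw [Nat.cast_sub (by omega)]
      rw [← h2]
      have h3 : (Nat.choose R (k + 1) : ℤ) * ((k : ℤ) + 1) = (Nat.choose R k : ℤ) * ((R - k : ℕ) : ℤ) := by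
        exact_mod_cast this
      linarith
    have h2 : ((R + 1 - (k + 1) : ℕ) : ℤ) = (R : ℤ) - k := by
      rw [Nat.cast_sub (by omega)]; push_cast; ring
    rw [h2]
    simp only [ht, if_neg (Nat.succ_ne_zero k), Nat.add_sub_cancel]
    set a := (∏ j ∈ range (k + 1), (m - (j : ℤ))) * ∏ j ∈ range (R + 1 - (k + 1)), (m + (j : ℤ))
    set b := (∏ j ∈ range (k + 1), (n - (j : ℤ))) * ∏ j ∈ range (R + 1 - (k + 1)), (n + (j : ℤ))
    set x := ∏ j ∈ range (R + 1), (m - ((k + 1 : ℕ) : ℤ) + (j : ℤ))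
    set y := ∏ j ∈ range (R + 1), (n - ((k + 1 : ℕ) : ℤ) + (j : ℤ))
    set z := ∏ j ∈ range (R + 1), (m - (k : ℤ) + (j : ℤ))
    set w := ∏ j ∈ range (R + 1), (n - (k : ℤ) + (j : ℤ))
    have pp : m * n * (x * y) = a * (m - (k + 1 : ℕ)) * (b * (n - (k + 1 : ℕ))) := by
      rw [← p1, ← p2]; ring
    have qq : m * n * (z * w) = a * (m + (R + 1 : ℕ) - (k + 1)) * (b * (n + (R + 1 : ℕ) - (k + 1))) := by
      rw [← q1, ← q2]; ring
    push_cast at pp qq ⊢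
    have : m * n * ((-1 : ℤ) ^ (k + 1) * ((R : ℤ) + 1 - (k + 1)) *
        ((Nat.choose R (k + 1) : ℤ) * x * y + (Nat.choose R k : ℤ) * z * w)) =
      (-1 : ℤ) ^ (k + 1) * (((R : ℤ) - k) * (Nat.choose R (k + 1) : ℤ) * (m * n * (x * y)) +
         (((R : ℤ) - k) * (Nat.choose R k : ℤ)) * (m * n * (z * w))) := by ring
    rw [this, c1, pp, qq]
    ring

end

theorem one_face_hypermap_gf_closed_form (r m n : ℕ) (hr : 1 ≤ r) (hm : 1 ≤ m) (hn : 1 ≤ n) :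
    (Nat.factorial r : ℤ) *
        ∑ σ : Equiv.Perm (Fin r), (m : ℤ) ^ cyc σ * (n : ℤ) ^ cyc (finRotate r * σ) =
      ∑ k ∈ Finset.range r, (-1 : ℤ) ^ k * (Nat.choose (r - 1) k : ℤ) *
        (∏ j ∈ Finset.range r, ((m : ℤ) - (k : ℤ) + (j : ℤ))) *
        (∏ j ∈ Finset.range r, ((n : ℤ) - (k : ℤ) + (j : ℤ))) := by
  obtain ⟨R, rfl⟩ : ∃ R, r = R + 1 := ⟨r - 1, by omega⟩
  cases R with
  | zero =>
    have h1 : ∀ g : Equiv.Perm (Fin (0 + 1)), cyc g = 1 := by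
      intro g
      have : g = 1 := by ext x; simp
      rw [this]
      simp [cyc]
    simp [h1]
  | succ R =>
    have h1 := main_identity R m n
    have h2 := final_algebra (R + 1) m n
    rw [← h1] at h2
    have hmn : (m : ℤ) * n ≠ 0 := by positivity
    apply mul_left_cancel₀ hmn
    rw [Nat.add_sub_cancel, ← h2, Nat.factorial_succ (R + 1)]
    simp only [cyc_eq_ncyc]
    push_cast
    ring
end

section
/- Define P_r(m,n) = ∑_{σ ∈ Sym_r} m^{cyc(σ)} n^{cyc(ξ_r σ)}. Then for all integers r ≥ 1 and m, n ≥ 1, the recursion (r+3) · P_{r+2}(m,n) = (2r+3)(m+n) · P_{r+1}(m,n) + r·((r+1)² − (m−n)²) · P_r(m,n) holds in ℤ. -/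
/-- The generating function P_r(m,n) = ∑_{σ ∈ Sym_r} m^{cyc σ} n^{cyc (ξ_r σ)}
counting rooted one-face hypermaps with r darts by edges and vertices. -/
def P (r : ℕ) (m n : ℤ) : ℤ :=
  ∑ σ : Equiv.Perm (Fin r), m ^ cyc σ * n ^ cyc (finRotate r * σ)

section Helpers
open Equiv Equiv.Perm Finset

/-- Number of orbits of a permutation. -/
noncomputable def oc {α : Type*} (σ : Perm α) : ℕ := Nat.card (Quotient (SameCycle.setoid σ))

/-- The orbit of a point. -/
def omk {α : Type*} (σ : Perm α) (a : α) : Quotient (SameCycle.setoid σ) :=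
  Quotient.mk (SameCycle.setoid σ) a

lemma omk_eq {α : Type*} (σ : Perm α) (a b : α) : omk σ a = omk σ b ↔ SameCycle σ a b :=
  Quotient.eq (r := SameCycle.setoid σ)

lemma omk_surj {α : Type*} (σ : Perm α) : Function.Surjective (omk σ) := Quotient.mk_surjective

lemma omk_apply {α : Type*} (σ : Perm α) (a : α) : omk σ (σ a) = omk σ a := by
  rw [omk_eq]; simp [SameCycle.refl]

lemma inv_sameCycle {α β : Type*} {σ : Perm α} {f : α → β} (h : ∀ a, f (σ a) = f a) {a b : α}
    (hab : SameCycle σ a b) : f a = f b := by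
  have h' : ∀ a, f (σ⁻¹ a) = f a := fun a => by rw [← h (σ⁻¹ a)]; simp
  obtain ⟨i, rfl⟩ := hab
  induction i using Int.induction_on with
  | zero => simp
  | succ i ih => rw [add_comm, zpow_add, zpow_one, Perm.mul_apply, h]; exact ih
  | pred i ih => rw [sub_eq_neg_add, zpow_add, zpow_neg_one, Perm.mul_apply, h']; exact ih

/-- Lift of an invariant function to orbits. -/
def olift {α β : Type*} (σ : Perm α) (f : α → β) (h : ∀ a, f (σ a) = f a) :
    Quotient (SameCycle.setoid σ) → β :=
  Quotient.lift f (fun _ _ hab => inv_sameCycle h hab)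

@[simp] lemma olift_omk {α β : Type*} (σ : Perm α) (f : α → β) (h : ∀ a, f (σ a) = f a) (a : α) :
    olift σ f h (omk σ a) = f a := rfl

lemma oind {α : Type*} {σ : Perm α} {p : Quotient (SameCycle.setoid σ) → Prop}
    (h : ∀ a, p (omk σ a)) (q) : p q := by
  obtain ⟨a, rfl⟩ := omk_surj σ q
  exact h a

lemma oc_permCongr {α β : Type*} (e : α ≃ β) (σ : Perm α) : oc (e.permCongr σ) = oc σ := by
  refine Nat.card_congr ⟨olift _ (fun b => omk σ (e.symm b)) ?_,
    olift _ (fun a => omk (e.permCongr σ) (e a)) ?_, ?_, ?_⟩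
  · intro b; simp [omk_apply]
  · intro a
    have := omk_apply (e.permCongr σ) (e a)
    simpa using this
  · exact oind (by simp)
  · exact oind (by simp)

lemma oc_conj {α : Type*} (g σ : Perm α) : oc (g * σ * g⁻¹) = oc σ := by
  rw [← oc_permCongr g σ]; congr 1

lemma oc_mul_comm {α : Type*} (g σ : Perm α) : oc (g * σ) = oc (σ * g) := by
  rw [← oc_conj g (σ * g)]; congr 1; group

lemma oc_optionCongr {α : Type*} [Finite α] (σ : Perm α) : oc (optionCongr σ) = oc σ + 1 := by
  unfold oc
  rw [← Finite.card_option]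
  refine Nat.card_congr ⟨olift _ (Option.map (omk σ)) ?_,
    fun o => o.elim (omk _ none) (olift _ (fun a => omk (optionCongr σ) (some a)) ?_), ?_, ?_⟩
  · rintro (_ | a) <;> simp [omk_apply]
  · intro a
    have := omk_apply (optionCongr σ) (some a)
    simpa using this
  · exact oind (by rintro (_ | a) <;> simp)
  · rintro (_ | q)
    · simp
    · obtain ⟨a, rfl⟩ := omk_surj σ q
      simp

/-- orbits of a block permutation -/
noncomputable def oblock {α : Type*} {p : α → Prop} [DecidablePred p] (a : Perm {x // p x})
    (b : Perm {x // ¬ p x}) : Quotient (SameCycle.setoid (a.subtypeCongr b)) ≃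
      Quotient (SameCycle.setoid a) ⊕ Quotient (SameCycle.setoid b) where
  toFun := olift _ (fun x => if h : p x then Sum.inl (omk a ⟨x, h⟩) else Sum.inr (omk b ⟨x, h⟩)) (by
    intro x
    by_cases h : p x
    · rw [Perm.subtypeCongr.left_apply _ _ h, dif_pos h, dif_pos (a ⟨x, h⟩).2]
      simp [omk_apply]
    · rw [Perm.subtypeCongr.right_apply _ _ h, dif_neg h, dif_neg (b ⟨x, h⟩).2]
      simp [omk_apply])
  invFun := Sum.elim (olift _ (fun x => omk _ x.1) (by
      intro x
      rw [← Perm.subtypeCongr.left_apply_subtype a b, omk_apply]))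
    (olift _ (fun x => omk _ x.1) (by
      intro x
      rw [← Perm.subtypeCongr.right_apply_subtype a b, omk_apply]))
  left_inv := oind (by
    intro x
    by_cases h : p x <;> simp [h])
  right_inv := by
    rintro (q | q)
    · revert q; exact oind (by intro x; simp [x.2])
    · revert q; exact oind (by intro x; simp [x.2])

lemma oc_block {α : Type*} [Finite α] {p : α → Prop} [DecidablePred p] (a : Perm {x // p x})
    (b : Perm {x // ¬ p x}) : oc (a.subtypeCongr b) = oc a + oc b := by
  unfold oc
  rw [Nat.card_congr (oblock a b), Nat.card_sum]

lemma sameCycle_swap_mul_s7 {α : Type*} [Finite α] [DecidableEq α] (σ : Perm α) (s t : α)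
    (h : ¬ SameCycle σ s t) : SameCycle (swap s t * σ) s t := by
  classical
  have hex : ∃ j, 0 < j ∧ (σ ^ j) s = s := by
    refine ⟨orderOf σ, orderOf_pos σ, by simp [pow_orderOf_eq_one]⟩
  obtain ⟨hj, hjs⟩ := Nat.find_spec hex
  set j := Nat.find hex with hjdef
  have key : ∀ i, i < j → ((swap s t * σ) ^ i) s = (σ ^ i) s := by
    intro i
    induction i with
    | zero => simp
    | succ i ih =>
      intro hi
      rw [pow_succ', Perm.mul_apply, ih (by omega), Perm.mul_apply, ← Perm.mul_apply σ, ← pow_succ']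
      apply swap_apply_of_ne_of_ne
      · intro hh
        exact Nat.find_min hex hi ⟨by omega, hh⟩
      · intro hh
        exact h ⟨(i + 1 : ℕ), by rw [zpow_natCast]; exact hh⟩
  refine ⟨(j : ℕ), ?_⟩
  obtain ⟨i, hi⟩ : ∃ i, j = i + 1 := ⟨j - 1, by omega⟩
  rw [zpow_natCast, hi, pow_succ', Perm.mul_apply, key i (by omega), Perm.mul_apply,
    ← Perm.mul_apply σ, ← pow_succ', ← hi, hjs, swap_apply_left]

lemma oc_swap_mul {α : Type*} [Finite α] [DecidableEq α] (σ : Perm α) (s t : α)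
    (h : ¬ SameCycle σ s t) : oc (swap s t * σ) + 1 = oc σ := by
  classical
  have hw := sameCycle_swap_mul_s7 σ s t h
  set τ := swap s t * σ with hτ
  have hst : omk σ s ≠ omk σ t := fun hh => h ((omk_eq _ _ _).1 hh)
  have hσ : ∀ a, omk τ (σ a) = omk τ a := by
    intro a
    rw [← omk_apply τ a, hτ, Perm.mul_apply, ← hτ]
    by_cases h1 : σ a = s
    · rw [h1, swap_apply_left]; exact (omk_eq _ _ _).2 hw
    by_cases h2 : σ a = t
    · rw [h2, swap_apply_right]; exact ((omk_eq _ _ _).2 hw).symm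
    rw [swap_apply_of_ne_of_ne h1 h2]
  let e : {q : Quotient (SameCycle.setoid σ) // q ≠ omk σ t} ≃ Quotient (SameCycle.setoid τ) :=
    { toFun := fun q => olift σ (omk τ) hσ q.1
      invFun := olift τ (fun a => if hq : omk σ a = omk σ t then ⟨omk σ s, hst⟩ else ⟨omk σ a, hq⟩) (by
        have hb : ∀ b, (if hq : omk σ (swap s t b) = omk σ t then
            (⟨omk σ s, hst⟩ : {q : Quotient (SameCycle.setoid σ) // q ≠ omk σ t})
            else ⟨omk σ (swap s t b), hq⟩) = 
            if hq : omk σ b = omk σ t then ⟨omk σ s, hst⟩ else ⟨omk σ b, hq⟩ := by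
          intro b
          by_cases h1 : b = s
          · subst h1; simp [hst]
          by_cases h2 : b = t
          · subst h2; simp [hst]
          rw [swap_apply_of_ne_of_ne h1 h2]
        intro a
        rw [hτ, Perm.mul_apply, hb]
        simp only [omk_apply])
      left_inv := by
        rintro ⟨q, hq⟩
        obtain ⟨a, rfl⟩ := omk_surj σ q
        simp [hq]
      right_inv := oind (by
        intro a
        by_cases hq : omk σ a = omk σ t
        · simp only [olift_omk, hq, dif_pos]
          rw [(omk_eq τ _ _).2 hw]
          exact ((omk_eq _ _ _).2 (by
            have := inv_sameCycle hσ ((omk_eq _ _ _).1 hq)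
            exact (omk_eq _ _ _).1 this)).symm
        · simp [hq]) }
  unfold oc
  rw [← Nat.card_congr e]
  have : Fintype (Quotient (SameCycle.setoid σ)) := Fintype.ofFinite _
  rw [Nat.card_eq_fintype_card, Nat.card_eq_fintype_card, Fintype.card_subtype_compl,
    Fintype.card_subtype_eq]
  have : 0 < Fintype.card (Quotient (SameCycle.setoid σ)) := Fintype.card_pos_iff.2 ⟨omk σ t⟩
  omega

lemma oc_eq {α : Type*} [Fintype α] [DecidableEq α] (σ : Perm α) :
    oc σ = σ.cycleType.card + (Finset.univ.filter fun x => σ x = x).card := by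
  classical
  have : Fintype (Quotient (SameCycle.setoid σ)) := Fintype.ofFinite _
  have h1 : oc σ = (univ.image (omk σ)).card := by
    rw [image_univ_of_surjective (omk_surj σ), card_univ, oc, Nat.card_eq_fintype_card]
  have h2 : (univ : Finset α) = σ.support ∪ univ.filter (fun x => σ x = x) := by
    ext x; simp [em']
  rw [h1]
  conv_lhs => rw [h2]
  rw [image_union, card_union_of_disjoint]
  · congr 1
    · have : σ.cycleType.card = (σ.support.image (cycleOf σ)).card := by
        rw [cycleType_def, Multiset.card_map]
        show σ.cycleFactorsFinset.card = _
        congr 1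
        ext c
        constructor
        · intro hc
          obtain ⟨x, hx⟩ := (mem_cycleFactorsFinset_iff.1 hc).1.nonempty_support
          exact mem_image.2 ⟨x, mem_cycleFactorsFinset_support_le hc hx, (cycle_is_cycleOf hx hc).symm⟩
        · intro hc
          obtain ⟨x, hx, rfl⟩ := mem_image.1 hc
          exact cycleOf_mem_cycleFactorsFinset_iff.2 hx
      rw [this]
      have hh : ∀ x ∈ σ.support, ∀ y ∈ σ.support,
          (omk σ x = omk σ y ↔ cycleOf σ x = cycleOf σ y) := by
        intro x hx y hy
        rw [omk_eq, sameCycle_iff_cycleOf_eq_of_mem_support hx hy]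
      apply card_bij (fun q _ => olift σ (cycleOf σ) (fun a => by
        exact (SameCycle.cycleOf_eq (by simp [SameCycle.refl])).symm) q)
      · intro q hq
        obtain ⟨x, hx, rfl⟩ := mem_image.1 hq
        exact mem_image_of_mem _ hx
      · intro q hq q' hq' he
        obtain ⟨x, hx, rfl⟩ := mem_image.1 hq
        obtain ⟨y, hy, rfl⟩ := mem_image.1 hq'
        exact (hh x hx y hy).2 he
      · intro c hc
        obtain ⟨x, hx, rfl⟩ := mem_image.1 hc
        exact ⟨omk σ x, mem_image_of_mem _ hx, rfl⟩
    · apply card_image_of_injOn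
      intro x hx y hy he
      simp only [coe_filter, mem_univ, true_and, Set.mem_setOf_eq] at hx hy
      exact SameCycle.eq_of_left ((omk_eq _ _ _).1 he) hx
  · rw [Finset.disjoint_left]
    intro q hq hq'
    obtain ⟨x, hx, rfl⟩ := mem_image.1 hq
    obtain ⟨y, hy, he⟩ := mem_image.1 hq'
    have hy' : σ y = y := by simpa using hy
    have := SameCycle.eq_of_left ((omk_eq _ _ _).1 he) hy'
    subst this
    exact (mem_support.1 hx) hy'

lemma sign_eq_oc {α : Type*} [Fintype α] [DecidableEq α] (σ : Perm α) :
    ((sign σ : ℤˣ) : ℤ) = (-1) ^ Fintype.card α * (-1) ^ oc σ := by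
  rw [sign_of_cycleType, oc_eq]
  have h : (univ.filter fun x => σ x = x).card + σ.support.card = Fintype.card α := by
    rw [← card_univ, ← card_filter_add_card_filter_not (s := univ) (fun x => σ x = x)]
    congr 1
  rw [← h, sum_cycleType]
  push_cast
  rw [pow_add, pow_add, pow_add]
  have : ((-1 : ℤ) ^ (univ.filter fun x => σ x = x).card) * ((-1 : ℤ) ^ (univ.filter fun x => σ x = x).card) = 1 := by
    rw [← mul_pow]; simp
  linear_combination (-(-1) ^ σ.support.card * (-1) ^ σ.cycleType.card) * this

lemma sum_oc {R : Type*} [CommRing R] (n : ℕ) : ∀ (α : Type) [Fintype α] [DecidableEq α], Fintype.card α = n →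
    ∀ x : R, ∑ σ : Perm α, x ^ oc σ = ∏ i ∈ range n, (x + i) := by
  induction n with
  | zero =>
    intro α _ _ h x
    have := Fintype.card_eq_zero_iff.1 h
    simp [oc]
  | succ n ih =>
    intro α _ _ h x
    have e : α ≃ Option (Fin n) := Fintype.equivOfCardEq (by simp [h])
    rw [← Equiv.sum_comp e.symm.permCongr]
    simp_rw [oc_permCongr]
    rw [← Equiv.sum_comp Equiv.Perm.decomposeOption.symm, Fintype.sum_prod_type]
    rw [Fintype.sum_option, prod_range_succ, ← ih (Fin n) (by simp) x]
    have h1 : ∀ σ : Perm (Fin n), oc (decomposeOption.symm (none, σ)) = oc σ + 1 := by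
      intro σ
      rw [← oc_optionCongr]; simp [decomposeOption]; rfl
    have h2 : ∀ (i : Fin n) (σ : Perm (Fin n)), oc (decomposeOption.symm (some i, σ)) = oc σ := by
      intro i σ
      have := oc_swap_mul (optionCongr σ) none (some i) (by
        intro hh
        have := SameCycle.eq_of_left hh (by simp [Function.IsFixedPt])
        simp at this)
      rw [oc_optionCongr] at this
      simpa [decomposeOption] using this
    simp_rw [h1, h2, pow_succ, ← sum_mul]
    simp
    ring


lemma sum_inv {α : Type} [Fintype α] [DecidableEq α] (S : Finset α) (F : Perm α → ℤ) :
    ∑ σ ∈ univ.filter (fun σ : Perm α => ∀ z, z ∈ S ↔ σ z ∈ S), F σ =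
      ∑ a : Perm {x // x ∈ S}, ∑ b : Perm {x // ¬ x ∈ S}, F (a.subtypeCongr b) := by
  rw [← Fintype.sum_prod_type' (f := fun (a : Perm {x // x ∈ S}) (b : Perm {x // ¬ x ∈ S}) =>
    F (a.subtypeCongr b))]
  symm
  apply sum_bij (fun ab _ => ab.1.subtypeCongr ab.2)
  · intro ab _
    simp only [mem_filter, mem_univ, true_and]
    intro z
    by_cases h : z ∈ S
    · rw [Perm.subtypeCongr.left_apply _ _ h]; simp [h]
    · rw [Perm.subtypeCongr.right_apply _ _ h]; simp [h, (ab.2 ⟨z, h⟩).2]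
  · intro ab _ ab' _ h
    exact subtypeCongrHom_injective (fun x => x ∈ S) h
  · intro σ hσ
    simp only [mem_filter, mem_univ, true_and] at hσ
    refine ⟨(σ.subtypePerm (fun z => (hσ z).symm), σ.subtypePerm (fun z => not_congr (hσ z).symm)),
      mem_univ _, ?_⟩
    ext z
    by_cases h : z ∈ S
    · rw [Perm.subtypeCongr.left_apply _ _ h]; simp
    · rw [Perm.subtypeCongr.right_apply _ _ h]; simp
  · intro _ _; rfl

lemma block_mul {α : Type} [DecidableEq α] (S : Finset α) (a a' : Perm {x // x ∈ S})
    (b b' : Perm {x // ¬ x ∈ S}) :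
    (a * a').subtypeCongr (b * b') = a.subtypeCongr b * a'.subtypeCongr b' :=
  map_mul (subtypeCongrHom (fun x => x ∈ S)) (a, b) (a', b')

open Classical in
lemma card_image_block {α : Type} [Fintype α] (S : Finset α) (a : Perm {x // x ∈ S})
    (b : Perm {x // ¬ x ∈ S}) : (S.image (omk (a.subtypeCongr b))).card = oc a := by
  have : Fintype (Quotient (SameCycle.setoid a)) := Fintype.ofFinite _
  rw [oc, Nat.card_eq_fintype_card, ← card_univ]
  symm
  apply card_bij (fun q _ => (oblock a b).symm (Sum.inl q))
  · intro q _
    obtain ⟨x, rfl⟩ := omk_surj a q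
    exact mem_image.2 ⟨x.1, x.2, rfl⟩
  · intro q _ q' _ h
    exact Sum.inl_injective ((oblock a b).symm.injective h)
  · intro q hq
    obtain ⟨x, hx, rfl⟩ := mem_image.1 hq
    exact ⟨omk a ⟨x, hx⟩, mem_univ _, rfl⟩

open Classical in
lemma long_ind {α : Type} [Fintype α] (ρ : Perm α) (x : α) :
    ∑ S ∈ univ.filter (fun S : Finset α => x ∈ S ∧ ∀ z, z ∈ S ↔ ρ z ∈ S),
      (-1 : ℤ) ^ (S.image (omk ρ)).card = if oc ρ = 1 then -1 else 0 := by
  have : Fintype (Quotient (SameCycle.setoid ρ)) := Fintype.ofFinite _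
  have h1 : ∑ S ∈ univ.filter (fun S : Finset α => x ∈ S ∧ ∀ z, z ∈ S ↔ ρ z ∈ S),
      (-1 : ℤ) ^ (S.image (omk ρ)).card = ∑ B ∈ (univ.erase (omk ρ x)).powerset,
      -(-1 : ℤ) ^ B.card := by
    symm
    have him : ∀ A : Finset (Quotient (SameCycle.setoid ρ)),
        (univ.filter (fun z => omk ρ z ∈ A)).image (omk ρ) = A := by
      intro A
      ext q
      obtain ⟨z, rfl⟩ := omk_surj ρ q
      simp only [mem_image, mem_filter, mem_univ, true_and]
      constructor
      · rintro ⟨y, hy, h⟩; rw [← h]; exact hy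
      · intro h; exact ⟨z, h, rfl⟩
    apply sum_bij (fun B _ => univ.filter (fun z => omk ρ z ∈ insert (omk ρ x) B))
    · intro B hB
      simp only [mem_filter, mem_univ, true_and, omk_apply, mem_insert, true_or, implies_true,
        and_self]
    · intro B hB B' hB' h
      have h' := congrArg (fun S => S.image (omk ρ)) h
      simp only [him] at h'
      have hB1 : omk ρ x ∉ B := fun hh => by simpa using mem_powerset.1 hB hh
      have hB2 : omk ρ x ∉ B' := fun hh => by simpa using mem_powerset.1 hB' hh
      rw [← erase_insert hB1, h', erase_insert hB2]
    · intro S hS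
      simp only [mem_filter, mem_univ, true_and] at hS
      refine ⟨(S.image (omk ρ)).erase (omk ρ x), ?_, ?_⟩
      · exact mem_powerset.2 (erase_subset_erase _ (subset_univ _))
      · rw [insert_erase (mem_image_of_mem _ hS.1)]
        ext z
        simp only [mem_filter, mem_univ, true_and, mem_image]
        constructor
        · rintro ⟨y, hy, h⟩
          have := inv_sameCycle (f := fun z => z ∈ S) (σ := ρ) (fun a => by simp [← hS.2 a])
            ((omk_eq _ _ _).1 h)
          exact this.mp hy
        · intro h; exact ⟨z, h, rfl⟩
    · intro B hB
      have hB1 : omk ρ x ∉ B := fun hh => by simpa using mem_powerset.1 hB hh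
      rw [him, card_insert_of_notMem hB1, pow_succ]; ring
  rw [h1, sum_neg_distrib, sum_powerset_neg_one_pow_card]
  have h2 : univ.erase (omk ρ x) = ∅ ↔ oc ρ = 1 := by
    rw [← card_eq_zero, card_erase_of_mem (mem_univ _), card_univ, oc, Nat.card_eq_fintype_card]
    have : 0 < Fintype.card (Quotient (SameCycle.setoid ρ)) := Fintype.card_pos_iff.2 ⟨omk ρ x⟩
    omega
  simp only [h2]
  split_ifs <;> simp

/-- The product function at a fixed permutation. -/
noncomputable def Qf {α : Type} [Fintype α] [DecidableEq α] (m n : ℤ) (ρ : Perm α) : ℤ :=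
  ∑ σ : Perm α, m ^ oc σ * n ^ oc (ρ * σ)

/-- Contribution of a block permutation sum. -/
noncomputable def hS {α : Type} [Fintype α] [DecidableEq α] (m n : ℤ) (S : Finset α) (σ : Perm α) : ℤ :=
  ∑ a : Perm {x // x ∈ S}, ∑ b : Perm {x // ¬ x ∈ S},
    (-1) ^ oc a * (m ^ oc σ * n ^ oc (a.subtypeCongr b * σ))

lemma sum_long {α : Type} [Fintype α] [DecidableEq α] (m n : ℤ) (x : α) :
    ∑ ρ : Perm α, (if oc ρ = 1 then Qf m n ρ else 0) =
      - ∑ S ∈ univ.filter (fun S : Finset α => x ∈ S), ∑ σ, hS m n S σ := by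
  classical
  have h : ∀ ρ : Perm α, (if oc ρ = 1 then Qf m n ρ else 0) =
      - ∑ S ∈ univ.filter (fun S : Finset α => x ∈ S),
        if (∀ z, z ∈ S ↔ ρ z ∈ S) then (-1 : ℤ) ^ (S.image (omk ρ)).card * Qf m n ρ else 0 := by
    intro ρ
    rw [← sum_filter, filter_filter, ← sum_mul]
    have := long_ind ρ x
    convert congrArg (fun t => -(t * Qf m n ρ)) this.symm using 1
    · split_ifs <;> simp
    · congr!
  simp_rw [h]
  rw [sum_neg_distrib, sum_comm]
  congr 1
  apply sum_congr rfl
  intro S _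
  rw [← sum_filter]
  rw [sum_inv S]
  unfold hS Qf
  rw [sum_comm]
  conv_rhs => rw [sum_comm]
  rw [sum_comm]
  apply sum_congr rfl
  intro a _
  rw [sum_comm]
  apply sum_congr rfl
  intro b _
  have hcard : (S.image (omk (a.subtypeCongr b))).card = oc a := by
    convert card_image_block S a b
  rw [mul_sum, hcard]

/-- preimage of a set -/
def gS {α : Type} [Fintype α] [DecidableEq α] (S : Finset α) (σ : Perm α) : Finset α :=
  univ.filter (fun z => σ z ∈ S)

lemma mem_gS {α : Type} [Fintype α] [DecidableEq α] (S : Finset α) (σ : Perm α) (z : α) :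
    z ∈ gS S σ ↔ σ z ∈ S := by simp [gS]

/-- Sum over permutations mapping `T` to `S`. -/
noncomputable def VS {α : Type} [Fintype α] [DecidableEq α] (m n : ℤ) (S T : Finset α) : ℤ :=
  ∑ σ ∈ univ.filter (fun σ : Perm α => gS S σ = T), hS m n S σ

lemma neg_one_oc {α : Type} [Fintype α] [DecidableEq α] (σ : Perm α) :
    (-1 : ℤ) ^ oc σ = (-1) ^ Fintype.card α * (sign σ : ℤˣ) := by
  rw [sign_eq_oc, ← mul_assoc, ← mul_pow]; simp

lemma VS_far {α : Type} [Fintype α] [DecidableEq α] (m n : ℤ) (S T : Finset α) (s t : α)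
    (hst : s ≠ t) (hs : s ∈ S) (ht : t ∈ S) (hsT : s ∉ T) (htT : t ∉ T) : VS m n S T = 0 := by
  have hw : ∀ σ : Perm α, gS S σ = T → hS m n S (swap s t * σ * swap s t) = - hS m n S σ := by
    intro σ hσ
    have h1 : σ s ∉ S := by rw [← mem_gS, hσ]; exact hsT
    have h2 : σ t ∉ S := by rw [← mem_gS, hσ]; exact htT
    unfold hS
    rw [← Equiv.sum_comp (Equiv.mulRight (swap (⟨s, hs⟩ : {x // x ∈ S}) ⟨t, ht⟩))]
    rw [← sum_neg_distrib]
    apply sum_congr rfl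
    intro a _
    rw [← Equiv.sum_comp (Equiv.mulRight (swap (⟨σ s, h1⟩ : {x // ¬ x ∈ S}) ⟨σ t, h2⟩))]
    rw [← sum_neg_distrib]
    apply sum_congr rfl
    intro b _
    simp only [coe_mulRight]
    have e1 : (swap (⟨s, hs⟩ : {x // x ∈ S}) ⟨t, ht⟩).subtypeCongr
        (swap (⟨σ s, h1⟩ : {x // ¬ x ∈ S}) ⟨σ t, h2⟩) = σ * swap s t * σ⁻¹ * swap s t := by
      have : σ * swap s t * σ⁻¹ = swap (σ s) (σ t) := by
        rw [Equiv.mul_swap_eq_swap_mul, mul_inv_cancel_right]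
      rw [this]
      ext z
      by_cases h : z ∈ S
      · rw [Perm.subtypeCongr.left_apply _ _ h]
        have : ∀ y ∈ S, swap (σ s) (σ t) y = y := fun y hy =>
          swap_apply_of_ne_of_ne (fun h => h1 (h ▸ hy)) (fun h => h2 (h ▸ hy))
        rw [Perm.mul_apply, this]
        · simp only [swap_apply_def, Subtype.mk.injEq]
          split_ifs <;> rfl
        · rw [swap_apply_def]; split_ifs <;> assumption
      · have hz : swap s t z = z := swap_apply_of_ne_of_ne (fun h' => h (by rw [h']; exact hs))
            (fun h' => h (by rw [h']; exact ht))
        rw [Perm.subtypeCongr.right_apply _ _ h, Perm.mul_apply, hz]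
        simp only [swap_apply_def, Subtype.mk.injEq]
        split_ifs <;> rfl
    rw [block_mul, e1]
    have e2 : a.subtypeCongr b * (σ * swap s t * σ⁻¹ * swap s t) * (swap s t * σ * swap s t)
        = a.subtypeCongr b * σ := by
      have := swap_mul_self s t
      calc _ = a.subtypeCongr b * (σ * swap s t * σ⁻¹ * (swap s t * swap s t) * σ * swap s t) := by
            group
        _ = a.subtypeCongr b * (σ * (swap s t * swap s t)) := by rw [this]; simp [mul_assoc]
        _ = _ := by rw [this, mul_one]
    have e3 : oc (swap s t * σ * swap s t) = oc σ := by
      conv_rhs => rw [← oc_conj (swap s t) σ, swap_inv]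
    rw [e2, e3, neg_one_oc, neg_one_oc, Perm.sign_mul, sign_swap (by simpa using hst)]
    push_cast
    ring
  have key : VS m n S T = - VS m n S T := by
    conv_lhs => unfold VS
    unfold VS
    rw [← sum_neg_distrib]
    have hg : ∀ σ : Perm α, gS S σ = T → gS S (swap s t * σ * swap s t) = T := by
      intro σ hσ
      ext z
      have hS' : ∀ y, swap s t y ∈ S ↔ y ∈ S := by
        intro y; rw [swap_apply_def]; split_ifs with h1 h2
        · simp [h1, hs, ht]
        · simp [h2, hs, ht]
        · rfl
      have hT' : ∀ y, swap s t y ∈ T ↔ y ∈ T := by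
        intro y; rw [swap_apply_def]; split_ifs with h1 h2
        · simp [h1, hsT, htT]
        · simp [h2, hsT, htT]
        · rfl
      rw [mem_gS, Perm.mul_apply, Perm.mul_apply, hS', ← mem_gS, hσ, hT']
    symm
    apply sum_bij (fun σ _ => swap s t * σ * swap s t)
    · intro σ h; simp only [mem_filter, mem_univ, true_and] at h ⊢; exact hg σ h
    · intro σ _ τ _ h; simpa using h
    · intro σ h
      simp only [mem_filter, mem_univ, true_and] at h
      refine ⟨swap s t * σ * swap s t, by simpa using hg σ h, ?_⟩
      simp [mul_assoc]
    · intro σ h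
      simp only [mem_filter, mem_univ, true_and] at h
      rw [hw σ h]
  linarith

lemma VS_near {α : Type} [Fintype α] [DecidableEq α] (m n : ℤ) (S : Finset α) (s t : α)
    (hs : s ∈ S) (ht : t ∉ S) : m * n * VS m n S (insert t (S.erase s)) = VS m n S S := by
  have hT' : ∀ y, swap s t y ∈ S ↔ y ∈ insert t (S.erase s) := by
    intro y; rw [swap_apply_def]; split_ifs with h1 h2
    · subst h1; simp [ht]; rintro rfl; exact ht hs
    · simp [h2, hs]
    · simp [h1, h2]
  have hT2 : ∀ y, swap s t y ∈ insert t (S.erase s) ↔ y ∈ S := by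
    intro y; rw [← hT']; simp
  unfold VS
  rw [mul_sum]
  symm
  apply sum_bij (fun σ _ => σ * swap s t)
  · intro σ h
    simp only [mem_filter, mem_univ, true_and] at h ⊢
    ext z
    rw [mem_gS, Perm.mul_apply, ← mem_gS, h, hT']
  · intro σ _ τ _ h; simpa using h
  · intro σ h
    simp only [mem_filter, mem_univ, true_and] at h
    refine ⟨σ * swap s t, ?_, by simp [mul_assoc]⟩
    simp only [mem_filter, mem_univ, true_and]
    ext z
    rw [mem_gS, Perm.mul_apply, ← mem_gS, h, hT2]
  · intro σ h
    simp only [mem_filter, mem_univ, true_and] at h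
    have hσ : ∀ z, σ z ∈ S ↔ z ∈ S := fun z => by rw [← mem_gS, h]
    unfold hS
    rw [mul_sum]
    apply sum_congr rfl
    intro a _
    rw [mul_sum]
    apply sum_congr rfl
    intro b _
    have key : ∀ τ : Perm α, (∀ z, τ z ∈ S ↔ z ∈ S) → oc τ = oc (τ * swap s t) + 1 := by
      intro τ hτ
      rw [oc_mul_comm, oc_swap_mul]
      intro hh
      have := inv_sameCycle (f := fun z => z ∈ S) (fun a => by simp [hτ a]) hh
      exact ht (this.mp hs)
    rw [key σ hσ, key (a.subtypeCongr b * σ), mul_assoc]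
    · ring
    · intro z
      rw [Perm.mul_apply, ← hσ z]
      by_cases h : σ z ∈ S
      · rw [Perm.subtypeCongr.left_apply _ _ h]; simp [h]
      · rw [Perm.subtypeCongr.right_apply _ _ h]; simp [h, (b ⟨σ z, h⟩).2]

lemma VS_other {α : Type} [Fintype α] [DecidableEq α] (m n : ℤ) (S T : Finset α) (hTS : T ≠ S)
    (h : ∀ s ∈ S, ∀ t ∉ S, insert t (S.erase s) ≠ T) : VS m n S T = 0 := by
  by_cases hc : T.card = S.card
  · have h1 : (S \ T).card = (T \ S).card := card_sdiff_comm hc.symm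
    by_cases h2 : 1 < (S \ T).card
    · obtain ⟨s, hs, t, ht, hst⟩ := one_lt_card.1 h2
      rw [mem_sdiff] at hs ht
      exact VS_far m n S T s t hst hs.1 ht.1 hs.2 ht.2
    · exfalso
      have h3 : (S \ T).card ≠ 0 := by
        intro h0
        rw [card_eq_zero, sdiff_eq_empty_iff_subset] at h0
        exact hTS (eq_of_subset_of_card_le h0 hc.le).symm
      have h4 : (S \ T).card = 1 := by omega
      obtain ⟨s, hs⟩ := card_eq_one.1 h4
      obtain ⟨t, ht⟩ := card_eq_one.1 (h1 ▸ h4)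
      have hs' : s ∈ S \ T := by simp [hs]
      have ht' : t ∈ T \ S := by simp [ht]
      rw [mem_sdiff] at hs' ht'
      apply h s hs'.1 t ht'.2
      ext z
      have hz1 : z ∈ S \ T ↔ z = s := by simp [hs]
      have hz2 : z ∈ T \ S ↔ z = t := by simp [ht]
      rw [mem_sdiff] at hz1 hz2
      simp only [mem_insert, mem_erase]
      tauto
  · unfold VS
    rw [filter_false_of_mem, sum_empty]
    intro σ _ hσ
    apply hc
    rw [← hσ]
    apply card_bij (fun z _ => σ z)
    · intro z hz; exact (mem_gS _ _ _).1 hz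
    · intro z _ y _ h; exact σ.injective h
    · intro z hz; exact ⟨σ.symm z, by simp [mem_gS, hz], by simp⟩

lemma sum_hS {α : Type} [Fintype α] [DecidableEq α] (m n : ℤ) (S : Finset α) :
    m * n * ∑ σ, hS m n S σ = (m * n + S.card * (Sᶜ).card) * VS m n S S := by
  have h1 : ∑ σ, hS m n S σ = ∑ T, VS m n S T := by
    unfold VS
    rw [sum_fiberwise]
  set I := (S ×ˢ Sᶜ).image (fun st => insert st.2 (S.erase st.1)) with hI
  have hSI : S ∉ I := by
    intro h
    obtain ⟨⟨s, t⟩, hst, he⟩ := mem_image.1 h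
    simp only [mem_product, mem_compl] at hst
    apply hst.2
    rw [← he]; simp
  have h2 : ∑ T, VS m n S T = ∑ T ∈ insert S I, VS m n S T := by
    symm
    apply sum_subset (subset_univ _)
    intro T _ hT
    rw [mem_insert, not_or] at hT
    apply VS_other _ _ _ _ hT.1
    intro s hs t ht he
    exact hT.2 (mem_image.2 ⟨(s, t), by simp [hs, ht], he⟩)
  rw [h1, h2, sum_insert hSI, mul_add, mul_sum, hI, sum_image]
  · rw [sum_congr rfl (g := fun _ => VS m n S S)]
    · simp [card_product]; ring
    · rintro ⟨s, t⟩ hst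
      simp only [mem_product, mem_compl] at hst
      exact VS_near m n S s t hst.1 hst.2
  · rintro ⟨s, t⟩ hst ⟨s', t'⟩ hst' he
    replace he : insert t (S.erase s) = insert t' (S.erase s') := he
    simp only [coe_product, Set.mem_prod, mem_coe, mem_compl] at hst hst'
    have e1 : t = t' := by
      have : t ∈ insert t' (S.erase s') := by rw [← he]; simp
      simpa [hst.2] using this
    have e2 : s = s' := by
      by_contra hne
      have : s ∈ insert t (S.erase s) := by
        rw [he]; simp [hst.1, hne]
      simp at this
      exact hst.2 (this ▸ hst.1)
    rw [e1, e2]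

/-- rising product -/
def pf (x : ℤ) (k : ℕ) : ℤ := ∏ i ∈ range k, (x + i)

lemma sum_sign {α : Type} [Fintype α] [DecidableEq α] (x : ℤ) :
    ∑ σ : Perm α, ((sign σ : ℤˣ) : ℤ) * x ^ oc σ =
      (-1) ^ Fintype.card α * pf (-x) (Fintype.card α) := by
  rw [pf, ← sum_oc _ α rfl, mul_sum]
  apply sum_congr rfl
  intro σ _
  rw [sign_eq_oc, neg_pow x]; ring

lemma VS_self {α : Type} [Fintype α] [DecidableEq α] (m n : ℤ) (S : Finset α) :
    VS m n S S = (-1) ^ S.card * (pf (-m) S.card * pf m (Sᶜ).card) *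
      (pf (-n) S.card * pf n (Sᶜ).card) := by
  have hc1 : Fintype.card {x // x ∈ S} = S.card := by simp
  have hc2 : Fintype.card {x // ¬ x ∈ S} = (Sᶜ).card := by
    rw [Fintype.card_subtype_compl]; simp [card_compl]
  have h0 : VS m n S S = ∑ σ ∈ univ.filter (fun σ : Perm α => ∀ z, z ∈ S ↔ σ z ∈ S), hS m n S σ := by
    unfold VS
    congr 1
    ext σ
    simp only [mem_filter, mem_univ, true_and, Finset.ext_iff, mem_gS]
    exact forall_congr' fun z => Iff.comm
  rw [h0, sum_inv]
  unfold hS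
  have h1 : ∀ (c : Perm {x // x ∈ S}) (d : Perm {x // ¬ x ∈ S}),
      ∑ a : Perm {x // x ∈ S}, ∑ b : Perm {x // ¬ x ∈ S},
      (-1 : ℤ) ^ oc a * (m ^ oc (c.subtypeCongr d) * n ^ oc (a.subtypeCongr b * c.subtypeCongr d)) =
      (-1) ^ S.card * (((sign c : ℤˣ) : ℤ) * m ^ oc c * m ^ oc d) *
        ((∑ a : Perm {x // x ∈ S}, ((sign a : ℤˣ) : ℤ) * n ^ oc a) *
          ∑ b : Perm {x // ¬ x ∈ S}, n ^ oc b) := by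
    intro c d
    rw [← Equiv.sum_comp (Equiv.mulRight c⁻¹), sum_mul, mul_sum]
    apply sum_congr rfl
    intro a _
    rw [← Equiv.sum_comp (Equiv.mulRight d⁻¹), mul_sum, mul_sum]
    apply sum_congr rfl
    intro b _
    simp only [coe_mulRight]
    rw [← block_mul, oc_block, oc_block, neg_one_oc, hc1, Perm.sign_mul, sign_inv]
    simp only [inv_mul_cancel_right]
    push_cast
    ring
  simp_rw [h1, ← sum_mul, ← mul_sum]
  rw [← sum_mul, sum_sign, sum_sign, sum_oc _ _ rfl, sum_oc _ _ rfl, hc1, hc2]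
  unfold pf
  have : ((-1 : ℤ) ^ S.card) * (-1 : ℤ) ^ S.card = 1 := by rw [← mul_pow]; simp
  linear_combination ((-1) ^ S.card * ((∏ i ∈ range S.card, (-m + (i:ℤ))) * (∏ i ∈ range (Sᶜ).card, (m + (i:ℤ)))) * ((∏ i ∈ range S.card, (-n + (i:ℤ))) * (∏ i ∈ range (Sᶜ).card, (n + (i:ℤ))))) * this

lemma cyc_eq_oc {r : ℕ} (σ : Perm (Fin r)) : cyc σ = oc σ := by
  rw [oc_eq, cyc]

lemma P_eq_Qf (r : ℕ) (m n : ℤ) : P r m n = Qf m n (finRotate r) := by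
  simp only [P, Qf, cyc_eq_oc]

lemma Qf_conj {α : Type} [Fintype α] [DecidableEq α] (m n : ℤ) (g ρ : Perm α) :
    Qf m n (g * ρ * g⁻¹) = Qf m n ρ := by
  unfold Qf
  rw [← Equiv.sum_comp (MulAut.conj g).toEquiv]
  apply sum_congr rfl
  intro σ _
  have h : ∀ τ, (MulAut.conj g).toEquiv τ = g * τ * g⁻¹ := fun _ => rfl
  rw [h, oc_conj]
  congr 2
  rw [← oc_conj g (ρ * σ)]
  congr 1
  group

lemma oc_eq_one_iff (r : ℕ) (ρ : Perm (Fin (r + 2))) : oc ρ = 1 ↔ ρ.cycleType = {r + 2} := by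
  have hsum := sum_cycleType ρ
  have h : (univ.filter fun x => ρ x = x).card + ρ.support.card = r + 2 := by
    have := card_filter_add_card_filter_not (s := (univ : Finset (Fin (r + 2)))) (fun x => ρ x = x)
    rw [card_univ, Fintype.card_fin] at this
    exact this
  rw [oc_eq]
  constructor
  · intro h1
    have h2 : ρ.cycleType.card ≠ 0 := by
      intro h0
      have := card_cycleType_eq_zero.1 h0
      subst this
      simp at h1
    have h3 : ρ.cycleType.card = 1 := by omega
    obtain ⟨c, hc⟩ := Multiset.card_eq_one.1 h3
    rw [hc] at hsum ⊢
    rw [Multiset.sum_singleton] at hsum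
    congr 1
    omega
  · intro h1
    rw [h1] at hsum ⊢
    rw [Multiset.sum_singleton] at hsum
    rw [Multiset.card_singleton]
    omega

lemma sum_long_eq (r : ℕ) (m n : ℤ) :
    ∑ ρ : Perm (Fin (r + 1)), (if oc ρ = 1 then Qf m n ρ else 0) = (r.factorial : ℤ) * P (r + 1) m n := by
  rcases r with _ | r
  · have hsub : ∀ ρ : Perm (Fin (0 + 1)), ρ = 1 := by
      intro ρ
      ext x
      have h1 := (ρ x).isLt
      have h2 := ((1 : Perm (Fin (0 + 1))) x).isLt
      omega
    have h : oc (1 : Perm (Fin (0 + 1))) = 1 := by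
      rw [oc_eq]; simp
    rw [P_eq_Qf, Fintype.sum_eq_single 1 (fun ρ hρ => absurd (hsub ρ) hρ), if_pos h,
      hsub (finRotate _)]
    simp
  · have h1 : ∀ ρ : Perm (Fin (r + 2)), oc ρ = 1 → Qf m n ρ = P (r + 2) m n := by
      intro ρ hρ
      rw [oc_eq_one_iff] at hρ
      have : IsConj (finRotate (r + 2)) ρ := by
        rw [isConj_iff_cycleType_eq, hρ, cycleType_finRotate]
      obtain ⟨g, hg⟩ := isConj_iff.1 this
      rw [P_eq_Qf, ← hg, Qf_conj]
    rw [← sum_filter, sum_congr rfl (g := fun _ => P (r + 2) m n)]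
    · rw [sum_const, nsmul_eq_mul]
      congr 2
      simp only [oc_eq_one_iff]
      rw [card_of_cycleType_singleton (by omega) (by simp)]
      simp
    · intro ρ hρ
      exact h1 ρ (mem_filter.1 hρ).2

lemma pf_succ (x : ℤ) (k : ℕ) : pf x (k + 1) = pf x k * (x + k) := by
  rw [pf, prod_range_succ]; rfl

lemma pf_succ' (x : ℤ) (k : ℕ) : pf x (k + 1) = x * pf (x + 1) k := by
  rw [pf, prod_range_succ', mul_comm, pf]
  congr 1
  · simp
  · apply prod_congr rfl; intro i _; push_cast; ring

lemma pf_add (x : ℤ) (j k : ℕ) : pf x j * pf (x + j) k = pf x (j + k) := by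
  rw [pf, pf, pf, prod_range_add]
  congr 1
  apply prod_congr rfl; intro i _; push_cast; ring

lemma pf_neg (x : ℤ) (j : ℕ) : pf (-x) (j + 1) = (-1) ^ (j + 1) * (x * pf (x - j) j) := by
  induction j with
  | zero => simp [pf]
  | succ j ih =>
    rw [pf_succ, ih, pf_succ' (x - (j + 1 : ℕ))]
    push_cast
    rw [show x - (j + 1 : ℤ) + 1 = x - j by ring]
    ring

lemma pf_mix (x : ℤ) (j r : ℕ) (h : j ≤ r) :
    pf (-x) (j + 1) * pf x (r - j) = (-1) ^ (j + 1) * (x * pf (x - j) r) := by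
  rw [pf_neg]
  have := pf_add (x - j) j (r - j)
  rw [sub_add_cancel, Nat.add_sub_cancel' h] at this
  rw [← this]; ring

lemma formula1 (r : ℕ) (m n : ℤ) (hm : m ≠ 0) (hn : n ≠ 0) :
    (r.factorial : ℤ) * P (r + 1) m n = ∑ j ∈ range (r + 1), (r.choose j : ℤ) *
      ((-1) ^ j * (m * n + (j + 1) * (r - j)) * (pf (m - j) r * pf (n - j) r)) := by
  have hmn : m * n ≠ 0 := mul_ne_zero hm hn
  apply mul_left_cancel₀ hmn
  rw [← sum_long_eq, sum_long m n (0 : Fin (r + 1)), mul_neg, mul_sum]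
  have h1 : ∀ S ∈ univ.filter (fun S : Finset (Fin (r + 1)) => 0 ∈ S),
      m * n * ∑ σ, hS m n S σ = (fun k : ℕ => (m * n + k * ((r + 1 - k : ℕ) : ℤ)) *
        ((-1) ^ k * (pf (-m) k * pf m (r + 1 - k)) * (pf (-n) k * pf n (r + 1 - k)))) S.card := by
    intro S _
    have hc : (Sᶜ).card = r + 1 - S.card := by rw [card_compl, Fintype.card_fin]
    rw [sum_hS, VS_self, hc]
  rw [sum_congr rfl h1]
  set f := (fun k : ℕ => (m * n + k * ((r + 1 - k : ℕ) : ℤ)) *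
        ((-1) ^ k * (pf (-m) k * pf m (r + 1 - k)) * (pf (-n) k * pf n (r + 1 - k)))) with hf
  have h2 : ∑ S ∈ univ.filter (fun S : Finset (Fin (r + 1)) => 0 ∈ S), f S.card =
      ∑ B ∈ ((univ : Finset (Fin (r + 1))).erase 0).powerset, (fun k => f (k + 1)) B.card := by
    symm
    have hB0 : ∀ B ∈ ((univ : Finset (Fin (r + 1))).erase 0).powerset, 0 ∉ B := fun B hB hh => by
      simpa using mem_powerset.1 hB hh
    apply sum_bij (fun B _ => insert 0 B)
    · intro B hB; simp
    · intro B hB B' hB' h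
      rw [← erase_insert (hB0 B hB), h, erase_insert (hB0 B' hB')]
    · intro S hS
      exact ⟨S.erase 0, mem_powerset.2 (erase_subset_erase _ (subset_univ _)),
        insert_erase (mem_filter.1 hS).2⟩
    · intro B hB
      rw [card_insert_of_notMem (hB0 B hB)]
  rw [h2, sum_powerset_apply_card (fun k => f (k + 1)), card_erase_of_mem (mem_univ _), card_univ, Fintype.card_fin,
    Nat.add_sub_cancel, mul_sum, ← sum_neg_distrib]
  apply sum_congr rfl
  intro j hj
  have hj' : j ≤ r := by simpa [Nat.lt_succ_iff] using hj
  rw [hf]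
  simp only [Nat.add_sub_add_right, nsmul_eq_mul]
  rw [pf_mix m j r hj', pf_mix n j r hj', Nat.cast_sub hj']
  have h3 : ((-1 : ℤ) ^ (j + 1)) * (-1) ^ (j + 1) = 1 := by rw [← mul_pow]; simp
  push_cast
  have h4 : (-1 : ℤ) ^ (j + 1) = - (-1) ^ j := by rw [pow_succ]; ring
  linear_combination (-(r.choose j : ℤ) * (m * n + (j + 1) * (r - j)) * (-1) ^ (j + 1) * (m * pf (m - j) r)
    * (n * pf (n - j) r)) * h3 - ((r.choose j : ℤ) * (m * n + (j + 1) * (r - j)) * (m * pf (m - j) r)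
    * (n * pf (n - j) r)) * h4

lemma choose_rel (r j : ℕ) : ((j : ℤ) + 1) * (r.choose (j + 1) : ℤ) = (r - j) * (r.choose j : ℤ) := by
  rcases le_or_gt j r with h | h
  · have := Nat.choose_succ_right_eq r j
    zify [h] at this
    linear_combination this
  · rw [Nat.choose_eq_zero_of_lt h, Nat.choose_eq_zero_of_lt (by omega)]; simp

lemma choose_rel' (r j : ℕ) : ((r : ℤ) + 1) * (r.choose j : ℤ) = (r + 1 - j) * ((r + 1).choose j : ℤ) := by
  rcases le_or_gt j (r + 1) with h | h
  · have := Nat.add_one_mul_choose_eq r j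
    have h2 := choose_rel (r + 1) j
    zify [h] at this
    push_cast at h2
    linear_combination this + h2
  · rw [Nat.choose_eq_zero_of_lt h, Nat.choose_eq_zero_of_lt (by omega)]; simp

/-- summand -/
def uu (r : ℕ) (m n : ℤ) (k : ℕ) : ℤ :=
  (-1) ^ k * (r.choose k : ℤ) * (pf (m - k) (r + 1) * pf (n - k) (r + 1))

lemma formula2 (r : ℕ) (m n : ℤ) (hm : m ≠ 0) (hn : n ≠ 0) (N : ℕ) (hN : r + 1 ≤ N) :
    ((r + 1).factorial : ℤ) * P (r + 1) m n = ∑ k ∈ range N, uu r m n k := by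
  have h0 : ∑ k ∈ range N, uu r m n k = ∑ k ∈ range (r + 1), uu r m n k := by
    symm
    apply sum_subset (range_subset_range.2 hN)
    intro k _ hk
    simp only [mem_range, not_lt] at hk
    rw [uu, Nat.choose_eq_zero_of_lt (by omega)]; simp
  rw [h0, Nat.factorial_succ]
  push_cast
  rw [mul_assoc, formula1 r m n hm hn, mul_sum]
  have h1 : ∀ j ∈ range (r + 1), ((r : ℤ) + 1) * ((r.choose j : ℤ) *
      ((-1) ^ j * (m * n + (j + 1) * (r - j)) * (pf (m - j) r * pf (n - j) r))) =
      uu r m n j - ((((j + 1 : ℕ) : ℤ)) * uu r m n (j + 1) - (j : ℤ) * uu r m n j) := by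
    intro j _
    unfold uu
    have e : ∀ x : ℤ, pf (x - (j + 1 : ℕ)) (r + 1) = (x - (j + 1)) * pf (x - j) r := by
      intro x
      rw [pf_succ']; push_cast
      rw [show x - ((j : ℤ) + 1) + 1 = x - j by ring]
    rw [e, e, pf_succ, pf_succ]
    push_cast
    have := choose_rel r j
    linear_combination (-(-1) ^ j * (m - (j + 1)) * (n - (j + 1)) * pf (m - j) r * pf (n - j) r) * this
  rw [sum_congr rfl h1, sum_sub_distrib, sum_range_sub (fun j => (j : ℤ) * uu r m n j)]
  simp [uu]

/-- telescoping certificate -/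
def GG (r : ℕ) (m n : ℤ) (k : ℕ) : ℤ :=
  (-1) ^ k * (k : ℤ) * ((r + 1).choose k : ℤ) * (pf (m - k) (r + 1) * pf (n - k) (r + 1)) *
    ((r + 1) * (k : ℤ) ^ 2 + (-3 * (r : ℤ) ^ 2 - 7 * r - 4 + m + n) * k +
      (2 * (r : ℤ) ^ 3 + 7 * (r : ℤ) ^ 2 + 8 * r + 3 - (r + 1) * (m + n) - (r + 3) * m * n))

lemma cert (q : ℕ) (m n : ℤ) (k : ℕ) :
    ((q : ℤ) + 2) * (((q : ℤ) + 4) * uu (q + 2) m n k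
      - (2 * q + 5) * (q + 3) * (m + n) * uu (q + 1) m n k
      - (q + 1) * (q + 2) * (q + 3) * ((q + 2) ^ 2 - (m - n) ^ 2) * uu q m n k) =
    GG (q + 1) m n (k + 1) - GG (q + 1) m n k := by
  have e : ∀ x : ℤ, pf (x - (k + 1 : ℕ)) (q + 1 + 1) = (x - (k + 1)) * pf (x - k) (q + 1) := by
    intro x
    rw [pf_succ']; push_cast
    rw [show x - ((k : ℤ) + 1) + 1 = x - k by ring]
  unfold uu GG
  rw [e, e, pf_succ _ (q + 2), pf_succ _ (q + 2), pf_succ _ (q + 1), pf_succ _ (q + 1)]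
  generalize pf (m - k) (q + 1) = X
  generalize pf (n - k) (q + 1) = Y
  have c1 := choose_rel (q + 1 + 1) k
  have c2 := choose_rel' (q + 1) k
  have c3 := choose_rel' q k
  rw [show q + 2 = q + 1 + 1 from rfl]
  generalize ((q + 1 + 1).choose (k + 1) : ℤ) = C1 at *
  generalize ((q + 1 + 1).choose k : ℤ) = C at *
  generalize ((q + 1).choose k : ℤ) = C2 at *
  generalize (q.choose k : ℤ) = C3 at *
  push_cast at *
  have c1' : (-1 : ℤ) ^ (k + 1) = - (-1) ^ k := by rw [pow_succ]; ring
  rw [c1']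
  generalize (-1 : ℤ) ^ k = w
  generalize (q : ℤ) = q at *
  generalize (k : ℤ) = k at *
  have c4 : (q + 1) * (q + 2) * C3 = (q + 1 - k) * (q + 2 - k) * C := by
    linear_combination (q + 2) * c3 + (q + 1 - k) * c2
  linear_combination (w * X * Y * (m - (k + 1)) * (n - (k + 1)) * ((q + 2) * (k + 1) ^ 2 +
      (-3 * (q + 1) ^ 2 - 7 * (q + 1) - 4 + m + n) * (k + 1) +
      (2 * (q + 1) ^ 3 + 7 * (q + 1) ^ 2 + 8 * (q + 1) + 3 - (q + 2) * (m + n) - (q + 4) * m * n))) * c1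
    - ((2 * q + 5) * (q + 3) * (m + n) * w * X * Y * (m - k + q + 1) * (n - k + q + 1)) * c2
    - ((q + 2) * (q + 3) * ((q + 2) ^ 2 - (m - n) ^ 2) * w * X * Y) * c4

end Helpers

/-- The three-term recursion
(r+3)·P_{r+2}(m,n) = (2r+3)(m+n)·P_{r+1}(m,n) + r((r+1)² − (m−n)²)·P_r(m,n). -/
theorem one_face_hypermap_gf_recursion (r : ℕ) (hr : 1 ≤ r) (m n : ℤ) (hm : 1 ≤ m) (hn : 1 ≤ n) :
    ((r : ℤ) + 3) * P (r + 2) m n =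
      (2 * (r : ℤ) + 3) * (m + n) * P (r + 1) m n +
        (r : ℤ) * (((r : ℤ) + 1) ^ 2 - (m - n) ^ 2) * P r m n := by
  obtain ⟨q, rfl⟩ : ∃ q, r = q + 1 := ⟨r - 1, by omega⟩
  have hm' : m ≠ 0 := by omega
  have hn' : n ≠ 0 := by omega
  have f1 := formula2 q m n hm' hn' (q + 3) (by omega)
  have f2 := formula2 (q + 1) m n hm' hn' (q + 3) (by omega)
  have f3 := formula2 (q + 2) m n hm' hn' (q + 3) (by omega)
  have hG : ∑ k ∈ Finset.range (q + 3), (GG (q + 1) m n (k + 1) - GG (q + 1) m n k) = 0 := by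
    rw [Finset.sum_range_sub (GG (q + 1) m n)]
    simp [GG]
  simp_rw [← cert, ← Finset.mul_sum, Finset.sum_sub_distrib, ← Finset.mul_sum] at hG
  rw [← f1, ← f2, ← f3] at hG
  have hq : ((q : ℤ) + 2) ≠ 0 := by positivity
  have hF : (((q + 2 + 1).factorial : ℕ) : ℤ) ≠ 0 := by positivity
  have hG' := (mul_eq_zero.1 hG).resolve_left hq
  apply mul_left_cancel₀ hF
  have g1 : (((q + 2 + 1).factorial : ℕ) : ℤ) = (q + 3) * (((q + 1 + 1).factorial : ℕ) : ℤ) := by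
    rw [Nat.factorial_succ]; push_cast; ring
  have g2 : (((q + 1 + 1).factorial : ℕ) : ℤ) = (q + 2) * (((q + 1).factorial : ℕ) : ℤ) := by
    rw [Nat.factorial_succ]; push_cast; ring
  rw [g1, g2] at hG' ⊢
  rw [show q + 2 + 1 = q + 1 + 2 from rfl] at hG'
  push_cast
  linear_combination hG'
end
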